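/- arXiv:1107.4736 — 2 statements merged into one kernel-verified Lean document; each statement's English description precedes it below -/
import Mathlib

section
/- Let T be an expanding Markov map with repeller Λ and let φ : Λ → ℝ be a non-negative potential satisfying the tempered distortion condition. Then for every y ∈ [0,1], the Hausdorff dimension of the shrinking target set satisfies dim D_y(φ) ≤ s(φ). -/
open Set Filter Topology

/-- An expanding Markov map with countably many inverse branches: a countable family
`{V i}` of pairwise disjoint subintervals of `[0,1]` with nonempty interior, and a map `T`
(given here as a global function `ℝ → ℝ`, only its behaviour on `⋃ i, V i` matters) which is
`C¹` on each `V i` with derivative `T'`, maps the interior of each `V i` onto `(0,1)`, is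
uniformly expanding, and has tempered distortion of the derivative. -/
structure ExpandingMarkovMap (A : Type) : Type where
  countable : Countable A
  nontriv : ∃ i j : A, i ≠ j
  V : A → Set ℝ
  T : ℝ → ℝ
  T' : ℝ → ℝ
  V_subset : ∀ i, V i ⊆ Icc (0:ℝ) 1
  V_ordConnected : ∀ i, (V i).OrdConnected
  V_interior_nonempty : ∀ i, (interior (V i)).Nonempty
  V_disjoint : Pairwise (Function.onFun Disjoint V)
  T_mapsTo : ∀ i, MapsTo T (V i) (Icc (0:ℝ) 1)
  T_C1 : ∀ i, ContDiffOn ℝ 1 T (V i)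
  T_hasDeriv : ∀ i, ∀ x ∈ V i, HasDerivWithinAt T (T' x) (V i) x
  T_maps_interior : ∀ i, T '' interior (V i) = Ioo (0:ℝ) 1
  expanding : ∃ ξ > (1:ℝ), ∃ N : ℕ, ∀ n, N ≤ n → ∀ ω : Fin n → A, ∀ x : ℝ,
    (∀ ν : Fin n, T^[(ν : ℕ)] x ∈ V (ω ν)) →
    ξ ^ n < ∏ l ∈ Finset.range n, |T' (T^[l] x)|
  distortion : ∃ ρ : ℕ → ℝ, Tendsto ρ atTop (𝓝 0) ∧
    ∀ n : ℕ, ∀ ω : Fin n → A, ∀ x y : ℝ,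
      (∀ ν : Fin n, T^[(ν : ℕ)] x ∈ V (ω ν)) → (∀ ν : Fin n, T^[(ν : ℕ)] y ∈ V (ω ν)) →
      Real.exp (-(n : ℝ) * ρ n) ≤
          (∏ l ∈ Finset.range n, |T' (T^[l] x)|) / (∏ l ∈ Finset.range n, |T' (T^[l] y)|) ∧
        (∏ l ∈ Finset.range n, |T' (T^[l] x)|) / (∏ l ∈ Finset.range n, |T' (T^[l] y)|) ≤
          Real.exp ((n : ℝ) * ρ n)

namespace ExpandingMarkovMap

variable {A : Type} (M : ExpandingMarkovMap A)

/-- The cylinder `V_ω = ⋂_{ν<n} T^{-ν}(V_{ω_ν})` associated to a word `ω ∈ A^n`. -/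
def cylinder {n : ℕ} (ω : Fin n → A) : Set ℝ :=
  {x | ∀ ν : Fin n, M.T^[(ν : ℕ)] x ∈ M.V (ω ν)}

/-- The repeller `Λ`: the set of points all of whose iterates are well defined. -/
def repeller : Set ℝ := {x | ∀ n : ℕ, M.T^[n] x ∈ ⋃ i, M.V i}

/-- The Birkhoff sum `S_n(f)(x) = ∑_{l<n} f(T^l x)`. -/
def birkhoff (f : ℝ → ℝ) (n : ℕ) (x : ℝ) : ℝ := ∑ l ∈ Finset.range n, f (M.T^[l] x)

/-- `S_n(f)(ω) = sup { S_n(f)(x) : x ∈ V_ω }` (`f` being a potential on `Λ`). -/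
noncomputable def birkhoffSup (f : ℝ → ℝ) {n : ℕ} (ω : Fin n → A) : ℝ :=
  sSup {v | ∃ x ∈ M.cylinder ω ∩ M.repeller, v = M.birkhoff f n x}

/-- The set of values `|f x - f y|` over pairs `x, y` in a common `n`-cylinder. -/
def varSet (f : ℝ → ℝ) (n : ℕ) : Set ℝ :=
  {d | ∃ ω : Fin n → A, ∃ x ∈ M.cylinder ω ∩ M.repeller, ∃ y ∈ M.cylinder ω ∩ M.repeller,
    d = |f x - f y|}

/-- The `n`-th level variation `var_n(f)`. -/
noncomputable def var (f : ℝ → ℝ) (n : ℕ) : ℝ := sSup (M.varSet f n)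

/-- The tempered distortion condition for a potential on `Λ`:
`var_1(f) < ∞` and `n⁻¹ var_n(S_n(f)) → 0`. -/
def Tempered (f : ℝ → ℝ) : Prop :=
  BddAbove (M.varSet f 1) ∧
    Tendsto (fun n : ℕ => M.var (M.birkhoff f n) n / (n : ℝ)) atTop (𝓝 0)

/-- The topological pressure `P(f) = lim_n n⁻¹ log ∑_{ω ∈ Aⁿ} exp S_n(f)(ω)`
(realised as a `limsup` in `EReal`; the limit exists for tempered potentials). -/
noncomputable def pressure (f : ℝ → ℝ) : EReal :=
  limsup (fun n : ℕ =>
    ((1 / (n : ℝ) : ℝ) : EReal) *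
      ENNReal.log (∑' ω : Fin n → A, ENNReal.ofReal (Real.exp (M.birkhoffSup f ω)))) atTop

/-- The potential `ψ = log |T'|`. -/
noncomputable def psi : ℝ → ℝ := fun x => Real.log |M.T' x|

/-- `s(φ) = inf { s : P(-s(ψ+φ)) ≤ 0 }`. -/
noncomputable def sdim (φ : ℝ → ℝ) : ℝ :=
  sInf {s : ℝ | M.pressure (fun x => -s * (M.psi x + φ x)) ≤ 0}

/-- The shrinking target set `D_y(φ)`. -/
def shrinkingTarget (y : ℝ) (φ : ℝ → ℝ) : Set ℝ :=
  ⋂ m : ℕ, ⋃ n : ℕ, ⋃ _ : m ≤ n,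
    {x | x ∈ M.repeller ∧ |M.T^[n] x - y| < Real.exp (-(M.birkhoff φ n x))}

/-- The shrinking target set `S_y(Φ)` for a sequence of radii `Φ`. -/
def shrinkingTargetSeq (y : ℝ) (Φ : ℕ → ℝ) : Set ℝ :=
  ⋂ m : ℕ, ⋃ n : ℕ, ⋃ _ : m ≤ n, {x | x ∈ M.repeller ∧ |M.T^[n] x - y| < Φ n}

/-- `g` is the iterated function system associated to `M`: `g i` is the inverse branch of
`T` on `V i`, a `C¹` map of `[0,1]` into `closure (V i)` with `g i (T x) = x` on `V i`. -/
def IsIFS (g : A → ℝ → ℝ) : Prop :=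
  ∀ i, ContDiffOn ℝ 1 (g i) (Icc (0:ℝ) 1) ∧ MapsTo (g i) (Icc (0:ℝ) 1) (closure (M.V i)) ∧
    ∀ x ∈ M.V i, g i (M.T x) = x

end ExpandingMarkovMap

/-- The composition `φ_τ = φ_{τ_1} ∘ ⋯ ∘ φ_{τ_n}` of the maps of an IFS along a word `τ`. -/
def ifsWord {A : Type} (g : A → ℝ → ℝ) {n : ℕ} (τ : Fin n → A) : ℝ → ℝ :=
  (List.ofFn fun ν : Fin n => g (τ ν)).foldr (· ∘ ·) id

/-- `C(y,n,r)`: the collection of cylinder sets `φ_τ([0,1])`, `τ ∈ Aⁿ`, contained in `B(y,r)`. -/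
def cylinderFamily {A : Type} (g : A → ℝ → ℝ) (y : ℝ) (n : ℕ) (r : ℝ) : Set (Set ℝ) :=
  {S | ∃ τ : Fin n → A, S = ifsWord g τ '' Icc (0:ℝ) 1 ∧ S ⊆ Metric.ball y r}

/-- Positive upper cylinder density of the IFS `g` at `y`. -/
def HasPUCD {A : Type} (g : A → ℝ → ℝ) (y : ℝ) : Prop :=
  ∃ lam : ℝ → ℕ,
    Tendsto lam (𝓝[>] (0:ℝ)) atTop ∧
    limsup (fun r : ℝ => Real.log r / (lam r : ℝ)) (𝓝[>] (0:ℝ)) < 0 ∧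
    0 < limsup (fun r : ℝ =>
        (ENNReal.ofReal r)⁻¹ * ∑' S : cylinderFamily g y (lam r) r, EMetric.diam (S : Set ℝ))
      (𝓝[>] (0:ℝ))

namespace ExpandingMarkovMap

variable {A : Type} (M : ExpandingMarkovMap A)

/-- The absolute value of the derivative of `T^n`, as given by the chain rule. -/
def absDeriv (n : ℕ) (x : ℝ) : ℝ := ∏ l ∈ Finset.range n, |M.T' (M.T^[l] x)|

variable {M}

lemma mem_cylinder_succ {n : ℕ} {ω : Fin (n + 1) → A} {x : ℝ} :
    x ∈ M.cylinder ω ↔ x ∈ M.V (ω 0) ∧ M.T x ∈ M.cylinder (fun ν : Fin n => ω ν.succ) := by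
  simp [cylinder, Fin.forall_fin_succ]

lemma mem_cylinder_one {i : A} {x : ℝ} :
    x ∈ M.cylinder (fun _ : Fin 1 => i) ↔ x ∈ M.V i := by
  simp [cylinder]

lemma iterate_mem_of_mem_cylinder {n : ℕ} {ω : Fin n → A} {x : ℝ} (hx : x ∈ M.cylinder ω)
    {l : ℕ} (hl : l < n) : M.T^[l] x ∈ M.V (ω ⟨l, hl⟩) :=
  hx ⟨l, hl⟩

lemma deriv_ne_zero {i : A} {x : ℝ} (hx : x ∈ M.V i) : M.T' x ≠ 0 := by
  obtain ⟨ρ, -, h⟩ := M.distortion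
  have h1 := (h 1 (fun _ => i) x x (mem_cylinder_one.2 hx) (mem_cylinder_one.2 hx)).1
  intro h0
  simp only [Finset.range_one, Finset.prod_singleton, Function.iterate_zero, id_eq, h0, abs_zero,
    div_zero] at h1
  exact (Real.exp_pos _).not_ge h1

lemma absDeriv_pos {n : ℕ} {ω : Fin n → A} {x : ℝ} (hx : x ∈ M.cylinder ω) :
    0 < M.absDeriv n x :=
  Finset.prod_pos fun _ hl =>
    abs_pos.2 (deriv_ne_zero (iterate_mem_of_mem_cylinder hx (Finset.mem_range.1 hl)))

lemma continuousOn_T (i : A) : ContinuousOn M.T (M.V i) := (M.T_C1 i).continuousOn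

lemma strictMonoOn_or_strictAntiOn (i : A) :
    StrictMonoOn M.T (M.V i) ∨ StrictAntiOn M.T (M.V i) := by
  have hc : Convex ℝ (M.V i) := (M.V_ordConnected i).convex
  have hd : ∀ x ∈ interior (M.V i), HasDerivWithinAt M.T (M.T' x) (interior (M.V i)) x :=
    fun x hx => (M.T_hasDeriv i x (interior_subset hx)).mono interior_subset
  rcases hasDerivWithinAt_forall_lt_or_forall_gt_of_forall_ne hc (M.T_hasDeriv i)
    (fun x hx => deriv_ne_zero hx) with h | h
  · exact .inr (strictAntiOn_of_hasDerivWithinAt_neg hc (continuousOn_T i) hd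
      fun x hx => h x (interior_subset hx))
  · exact .inl (strictMonoOn_of_hasDerivWithinAt_pos hc (continuousOn_T i) hd
      fun x hx => h x (interior_subset hx))

lemma ordConnected_cylinder : ∀ {n : ℕ} (ω : Fin n → A), (M.cylinder ω).OrdConnected
  | 0, ω => by
    have : M.cylinder ω = univ := by ext; simp [cylinder]
    rw [this]; exact ordConnected_univ
  | n + 1, ω => by
    refine ⟨fun x hx z hz w hw => ?_⟩
    rw [mem_cylinder_succ] at hx hz ⊢
    have hwV := (M.V_ordConnected _).out hx.1 hz.1 hw
    refine ⟨hwV, ?_⟩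
    have ih := ordConnected_cylinder (fun ν : Fin n => ω ν.succ)
    rcases strictMonoOn_or_strictAntiOn (M := M) (ω 0) with h | h
    · exact ih.out hx.2 hz.2 ⟨h.monotoneOn hx.1 hwV hw.1, h.monotoneOn hwV hz.1 hw.2⟩
    · exact ih.out hz.2 hx.2 ⟨h.antitoneOn hwV hz.1 hw.2, h.antitoneOn hx.1 hwV hw.1⟩

lemma hasDerivWithinAt_iterate : ∀ {n : ℕ} {ω : Fin n → A} {x : ℝ}, x ∈ M.cylinder ω →
    HasDerivWithinAt M.T^[n] (∏ l ∈ Finset.range n, M.T' (M.T^[l] x)) (M.cylinder ω) x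
  | 0, _, x, _ => by simpa using hasDerivWithinAt_id x _
  | n + 1, ω, x, hx => by
    have hx' := mem_cylinder_succ.1 hx
    have h1 := hasDerivWithinAt_iterate hx'.2
    have h2 := (M.T_hasDeriv _ x hx'.1).mono
      (fun z (hz : z ∈ M.cylinder ω) => (mem_cylinder_succ.1 hz).1)
    rw [Finset.prod_range_succ']
    exact h1.comp x h2 fun z hz => (mem_cylinder_succ.1 hz).2

/-- Mean value theorem for `T^n` on a cylinder. -/
lemma exists_absDeriv_mul_eq {n : ℕ} {ω : Fin n → A} {u v : ℝ} (hu : u ∈ M.cylinder ω)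
    (hv : v ∈ M.cylinder ω) :
    ∃ z ∈ M.cylinder ω, |M.T^[n] u - M.T^[n] v| = M.absDeriv n z * |u - v| := by
  wlog huv : u < v generalizing u v
  · rcases (not_lt.1 huv).eq_or_lt with rfl | h
    · exact ⟨v, hu, by simp⟩
    · obtain ⟨z, hz, h⟩ := this hv hu h
      exact ⟨z, hz, by rw [abs_sub_comm, h, abs_sub_comm]⟩
  have hsub : Icc u v ⊆ M.cylinder ω := (ordConnected_cylinder ω).out hu hv
  obtain ⟨z, hz, h⟩ := exists_hasDerivAt_eq_slope M.T^[n]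
    (fun x => ∏ l ∈ Finset.range n, M.T' (M.T^[l] x)) huv
    (fun x hx => ((hasDerivWithinAt_iterate (hsub hx)).mono hsub).continuousWithinAt)
    (fun x hx => (hasDerivWithinAt_iterate (hsub (Ioo_subset_Icc_self hx))).hasDerivAt
      (mem_of_superset (Icc_mem_nhds hx.1 hx.2) hsub))
  refine ⟨z, hsub (Ioo_subset_Icc_self hz), ?_⟩
  have hne : v - u ≠ 0 := sub_ne_zero.2 huv.ne'
  rw [absDeriv, ← Finset.abs_prod, ← abs_mul, h, abs_sub_comm, ← abs_neg (_ * _)]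
  congr 1
  field_simp
  ring

lemma continuousOn_iterate {n : ℕ} (ω : Fin n → A) : ContinuousOn M.T^[n] (M.cylinder ω) :=
  fun _ hx => (hasDerivWithinAt_iterate hx).continuousWithinAt

lemma interior_V_subset (i : A) : interior (M.V i) ⊆ Ioo 0 1 := by
  simpa using interior_mono (M.V_subset i)

lemma exists_mem_cylinder_iterate_eq : ∀ {n : ℕ} (ω : Fin n → A) {z : ℝ}, z ∈ Ioo (0:ℝ) 1 →
    ∃ x ∈ M.cylinder ω ∩ Ioo 0 1, M.T^[n] x = z
  | 0, _, z, hz => ⟨z, ⟨fun ν => ν.elim0, hz⟩, rfl⟩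
  | n + 1, ω, z, hz => by
    obtain ⟨x', ⟨hx', hx'I⟩, rfl⟩ := exists_mem_cylinder_iterate_eq (fun ν : Fin n => ω ν.succ) hz
    rw [← M.T_maps_interior (ω 0)] at hx'I
    obtain ⟨x, hx, rfl⟩ := hx'I
    exact ⟨x, ⟨mem_cylinder_succ.2 ⟨interior_subset hx, hx'⟩, interior_V_subset _ hx⟩, rfl⟩

lemma iterate_mem_repeller {x : ℝ} (hx : x ∈ M.repeller) (l : ℕ) : M.T^[l] x ∈ M.repeller :=
  fun n => by rw [← Function.iterate_add_apply]; exact hx _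

lemma mem_repeller_of_iterate {n : ℕ} {ω : Fin n → A} {x : ℝ} (hx : x ∈ M.cylinder ω)
    (h : M.T^[n] x ∈ M.repeller) : x ∈ M.repeller := by
  intro k
  rcases lt_or_ge k n with hk | hk
  · exact mem_iUnion.2 ⟨_, iterate_mem_of_mem_cylinder hx hk⟩
  · have := h (k - n)
    rwa [← Function.iterate_add_apply, Nat.sub_add_cancel hk] at this

lemma exists_mem_cylinder_of_mem_repeller {x : ℝ} (hx : x ∈ M.repeller) (n : ℕ) :
    ∃ ω : Fin n → A, x ∈ M.cylinder ω := by
  choose a ha using fun k => mem_iUnion.1 (hx k)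
  exact ⟨fun ν => a ν, fun ν => ha ν⟩

/-- A branch of `T^n` whose graph crosses the diagonal has a periodic point. -/
lemma exists_mem_repeller_of_le_of_le {n : ℕ} (hn : 0 < n) {ω : Fin n → A} {u v : ℝ}
    (hu : u ∈ M.cylinder ω ∩ Ioo 0 1) (hv : v ∈ M.cylinder ω ∩ Ioo 0 1)
    (hu' : u ≤ M.T^[n] u) (hv' : M.T^[n] v ≤ v) : ∃ z ∈ M.repeller, z ∈ Ioo (0:ℝ) 1 := by
  obtain ⟨x, ⟨hx, hxI⟩, h⟩ := (((ordConnected_cylinder ω).inter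
    ordConnected_Ioo).isPreconnected).intermediate_value₂ hv hu
    ((continuousOn_iterate ω).mono inter_subset_left) continuousOn_id hv' hu'
  have hper : Function.IsPeriodicPt M.T n x := h
  refine ⟨x, fun k => ?_, hxI⟩
  rw [← hper.iterate_mod_apply]
  exact mem_iUnion.2 ⟨_, iterate_mem_of_mem_cylinder hx (Nat.mod_lt k hn)⟩

lemma exists_forall_V_lt : ∃ i j : A, ∀ x ∈ M.V i, ∀ w ∈ M.V j, x < w := by
  have key : ∀ i j : A, i ≠ j → ∀ a ∈ M.V i, ∀ b ∈ M.V j, a < b →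
      ∀ x ∈ M.V i, ∀ w ∈ M.V j, x < w := by
    intro i j hij a ha b hb hab x hx w hw
    have hd := disjoint_left.1 (M.V_disjoint hij)
    by_contra! hwx
    rcases le_or_gt w a with hwa | hwa
    · exact hd ha ((M.V_ordConnected j).out hw hb ⟨hwa, hab.le⟩)
    · exact hd ((M.V_ordConnected i).out ha hx ⟨hwa.le, hwx⟩) hw
  obtain ⟨i, j, hij⟩ := M.nontriv
  obtain ⟨a, ha⟩ := (M.V_interior_nonempty i).mono interior_subset
  obtain ⟨b, hb⟩ := (M.V_interior_nonempty j).mono interior_subset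
  have hne : a ≠ b := by
    rintro rfl
    exact disjoint_left.1 (M.V_disjoint hij) ha hb
  rcases hne.lt_or_gt with h | h
  · exact ⟨i, j, key i j hij a ha b hb h⟩
  · exact ⟨j, i, key j i hij.symm b hb a ha h⟩

lemma exists_mem_repeller_Ioo : ∃ z ∈ M.repeller, z ∈ Ioo (0:ℝ) 1 := by
  obtain ⟨i, j, hij⟩ := exists_forall_V_lt (M := M)
  obtain ⟨c, hc⟩ := M.V_interior_nonempty j
  obtain ⟨a, ha⟩ := M.V_interior_nonempty i
  rcases strictMonoOn_or_strictAntiOn (M := M) i with h | h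
  · obtain ⟨e, he, hea⟩ := (M.T_maps_interior i).ge (interior_V_subset i ha)
    obtain ⟨u, hu, huc⟩ := exists_mem_cylinder_iterate_eq (n := 2) ![i, j] (interior_V_subset j hc)
    obtain ⟨v, hv, hve⟩ := exists_mem_cylinder_iterate_eq (n := 2) ![i, j] (interior_V_subset i he)
    refine exists_mem_repeller_of_le_of_le two_pos hu hv ?_ ?_
    · rw [huc]
      exact (hij u (hu.1 0) c (interior_subset hc)).le
    · rw [hve]
      refine ((h.lt_iff_lt (interior_subset he) (hv.1 0)).1 ?_).le
      rw [hea]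
      exact hij a (interior_subset ha) _ (hv.1 1)
  · obtain ⟨u, hu, huc⟩ := (M.T_maps_interior i).ge (interior_V_subset j hc)
    obtain ⟨v, hv, hvu⟩ := (M.T_maps_interior i).ge (interior_V_subset i hu)
    have hu' := interior_subset hu
    have hv' := interior_subset hv
    have huc' : u < M.T u := by rw [huc]; exact hij u hu' c (interior_subset hc)
    refine exists_mem_repeller_of_le_of_le one_pos
      ⟨mem_cylinder_one.2 hu', interior_V_subset i hu⟩
      ⟨mem_cylinder_one.2 hv', interior_V_subset i hv⟩ huc'.le ?_
    rw [Function.iterate_one, hvu]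
    refine ((h.lt_iff_gt hv' hu').1 ?_).le
    rwa [hvu]

lemma cylinder_inter_repeller_nonempty {n : ℕ} (ω : Fin n → A) :
    (M.cylinder ω ∩ M.repeller).Nonempty := by
  obtain ⟨z, hz, hzI⟩ := exists_mem_repeller_Ioo (M := M)
  obtain ⟨x, hx, rfl⟩ := exists_mem_cylinder_iterate_eq (M := M) ω hzI
  exact ⟨x, hx.1, mem_repeller_of_iterate hx.1 hz⟩

lemma exists_absDeriv_le : ∃ ρ : ℕ → ℝ, Tendsto ρ atTop (𝓝 0) ∧
    ∀ (n : ℕ) (ω : Fin n → A), ∀ x ∈ M.cylinder ω, ∀ z ∈ M.cylinder ω,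
      M.absDeriv n x ≤ Real.exp (n * ρ n) * M.absDeriv n z := by
  obtain ⟨ρ, hρ, h⟩ := M.distortion
  exact ⟨ρ, hρ, fun n ω x hx z hz => (div_le_iff₀ (absDeriv_pos hz)).1 (h n ω x z hx hz).2⟩

lemma exists_le_log_absDeriv : ∃ lam > (0:ℝ), ∃ N : ℕ, ∀ n, N ≤ n → ∀ ω : Fin n → A,
    ∀ x ∈ M.cylinder ω, n * lam ≤ Real.log (M.absDeriv n x) := by
  obtain ⟨ξ, hξ, N, h⟩ := M.expanding
  refine ⟨Real.log ξ, Real.log_pos hξ, N, fun n hn ω x hx => ?_⟩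
  rw [← Real.log_pow]
  exact Real.log_le_log (pow_pos (one_pos.trans hξ) n) (h n hn ω x hx).le

lemma birkhoff_neg_mul {n : ℕ} {ω : Fin n → A} {x : ℝ} (hx : x ∈ M.cylinder ω) (s : ℝ)
    (φ : ℝ → ℝ) : M.birkhoff (fun x => -s * (M.psi x + φ x)) n x =
      -s * (Real.log (M.absDeriv n x) + M.birkhoff φ n x) := by
  have hlog : Real.log (M.absDeriv n x) = ∑ l ∈ Finset.range n, M.psi (M.T^[l] x) :=
    Real.log_prod fun l hl => abs_ne_zero.2
      (deriv_ne_zero (iterate_mem_of_mem_cylinder hx (Finset.mem_range.1 hl)))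
  rw [hlog, birkhoff, birkhoff, ← Finset.mul_sum, Finset.sum_add_distrib]

lemma birkhoff_nonneg {φ : ℝ → ℝ} (hφ0 : ∀ x ∈ M.repeller, 0 ≤ φ x) {x : ℝ}
    (hx : x ∈ M.repeller) (n : ℕ) : 0 ≤ M.birkhoff φ n x :=
  Finset.sum_nonneg fun l _ => hφ0 _ (iterate_mem_repeller hx l)

lemma bddAbove_varSet_birkhoff {f : ℝ → ℝ} (hf : BddAbove (M.varSet f 1)) (n : ℕ) :
    BddAbove (M.varSet (M.birkhoff f n) n) := by
  obtain ⟨C, hC⟩ := hf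
  refine ⟨n * C, ?_⟩
  rintro _ ⟨ω, x, hx, z, hz, rfl⟩
  rw [birkhoff, birkhoff, ← Finset.sum_sub_distrib]
  refine (Finset.abs_sum_le_sum_abs _ _).trans ?_
  rw [← nsmul_eq_mul]
  refine (Finset.sum_le_card_nsmul _ _ C fun l hl => hC ?_).trans_eq (by rw [Finset.card_range])
  have hl := Finset.mem_range.1 hl
  exact ⟨fun _ => ω ⟨l, hl⟩,
    _, ⟨mem_cylinder_one.2 (iterate_mem_of_mem_cylinder hx.1 hl), iterate_mem_repeller hx.2 l⟩,
    _, ⟨mem_cylinder_one.2 (iterate_mem_of_mem_cylinder hz.1 hl), iterate_mem_repeller hz.2 l⟩,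
    rfl⟩

lemma abs_birkhoff_sub_le {φ : ℝ → ℝ} (hφ : M.Tempered φ) {n : ℕ} {ω : Fin n → A} {x z : ℝ}
    (hx : x ∈ M.cylinder ω ∩ M.repeller) (hz : z ∈ M.cylinder ω ∩ M.repeller) :
    |M.birkhoff φ n x - M.birkhoff φ n z| ≤ M.var (M.birkhoff φ n) n :=
  le_csSup (bddAbove_varSet_birkhoff hφ.1 n) ⟨ω, x, hx, z, hz, rfl⟩

variable (M) in
/-- The partition function `∑_{ω ∈ Aⁿ} exp S_n(f)(ω)`. -/
noncomputable def partitionSum (f : ℝ → ℝ) (n : ℕ) : ENNReal :=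
  ∑' ω : Fin n → A, ENNReal.ofReal (Real.exp (M.birkhoffSup f ω))

lemma one_div_mul_log_le_iff {n : ℕ} (hn : 0 < n) (Z : ENNReal) (c : ℝ) :
    ((1 / (n : ℝ) : ℝ) : EReal) * ENNReal.log Z ≤ c ↔ Z ≤ ENNReal.ofReal (Real.exp (n * c)) := by
  have hn' : (0:ℝ) < n := by exact_mod_cast hn
  rw [← EReal.exp_coe, ← ENNReal.log_le_log_iff, EReal.log_exp]
  induction ENNReal.log Z with
  | bot => simp [EReal.coe_mul_bot_of_pos (inv_pos.2 hn')]
  | top =>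
    rw [EReal.coe_mul_top_of_pos (one_div_pos.2 hn')]
    simp only [top_le_iff, EReal.coe_ne_top]
  | coe r =>
    rw [← EReal.coe_mul, EReal.coe_le_coe_iff, EReal.coe_le_coe_iff, one_div,
      inv_mul_le_iff₀ hn']

lemma pressure_nonpos {f : ℝ → ℝ} {a : ℕ → ℝ} (ha : Tendsto a atTop (𝓝 0))
    (h : ∀ n, 0 < n → M.partitionSum f n ≤ ENNReal.ofReal (Real.exp (n * a n))) :
    M.pressure f ≤ 0 := by
  have hle : M.pressure f ≤ limsup (fun n => (a n : EReal)) atTop :=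
    limsup_le_limsup ((eventually_gt_atTop 0).mono fun n hn =>
      (one_div_mul_log_le_iff hn _ _).2 (h n hn))
  have hlim : Tendsto (fun n => (a n : EReal)) atTop (𝓝 ((0 : ℝ) : EReal)) :=
    EReal.tendsto_coe.2 ha
  rwa [hlim.limsup_eq] at hle

lemma eventually_partitionSum_le {f : ℝ → ℝ} (hf : M.pressure f ≤ 0) {η : ℝ} (hη : 0 < η) :
    ∀ᶠ n : ℕ in atTop, M.partitionSum f n ≤ ENNReal.ofReal (Real.exp (n * η)) := by
  have hlt : M.pressure f < (η : EReal) := hf.trans_lt (by exact_mod_cast hη)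
  filter_upwards [eventually_lt_of_limsup_lt hlt, eventually_gt_atTop 0] with n hn hn0
  exact (one_div_mul_log_le_iff hn0 _ _).1 hn.le

lemma disjoint_cylinder {n : ℕ} {ω τ : Fin n → A} (h : ω ≠ τ) :
    Disjoint (M.cylinder ω) (M.cylinder τ) := by
  obtain ⟨ν, hν⟩ := Function.ne_iff.1 h
  exact disjoint_left.2 fun x hx hx' => disjoint_left.1 (M.V_disjoint hν) (hx ν) (hx' ν)

lemma tsum_volume_cylinder_le {n : ℕ} (hn : 0 < n) :
    ∑' ω : Fin n → A, MeasureTheory.volume (M.cylinder ω) ≤ 1 := by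
  have := M.countable
  rw [← MeasureTheory.measure_iUnion (fun _ _ h => disjoint_cylinder h)
    fun ω => (ordConnected_cylinder ω).measurableSet]
  calc _ ≤ MeasureTheory.volume (Icc (0:ℝ) 1) := MeasureTheory.measure_mono
        (iUnion_subset fun ω x (hx : x ∈ M.cylinder ω) => M.V_subset _ (hx ⟨0, hn⟩))
    _ = 1 := by simp

lemma pressure_neg_one_nonpos {φ : ℝ → ℝ} (hφ0 : ∀ x ∈ M.repeller, 0 ≤ φ x) :
    M.pressure (fun x => -1 * (M.psi x + φ x)) ≤ 0 := by
  obtain ⟨ρ, hρ, hdist⟩ := exists_absDeriv_le (M := M)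
  have key : ∀ n (ω : Fin n → A), ENNReal.ofReal
      (Real.exp (M.birkhoffSup (fun x => -1 * (M.psi x + φ x)) ω)) ≤
      ENNReal.ofReal (2 * Real.exp (n * ρ n)) * MeasureTheory.volume (M.cylinder ω) := by
    intro n ω
    obtain ⟨u, hu, huT⟩ := exists_mem_cylinder_iterate_eq (M := M) ω
      (z := 1 / 4) ⟨by norm_num, by norm_num⟩
    obtain ⟨v, hv, hvT⟩ := exists_mem_cylinder_iterate_eq (M := M) ω
      (z := 3 / 4) ⟨by norm_num, by norm_num⟩
    obtain ⟨z, hz, hzuv⟩ := exists_absDeriv_mul_eq hu.1 hv.1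
    have hhalf : M.absDeriv n z * |u - v| = 1 / 2 := by rw [← hzuv, huT, hvT]; norm_num [abs_of_neg]
    have huv : 0 < |u - v| := by
      refine (abs_nonneg _).lt_of_ne fun h => ?_
      rw [← h] at hhalf
      norm_num at hhalf
    have hsup : M.birkhoffSup (fun x => -1 * (M.psi x + φ x)) ω ≤
        Real.log (2 * Real.exp (n * ρ n) * |u - v|) := by
      obtain ⟨p, hp⟩ := cylinder_inter_repeller_nonempty (M := M) ω
      refine csSup_le ⟨_, p, hp, rfl⟩ ?_
      rintro _ ⟨x, hx, rfl⟩
      rw [birkhoff_neg_mul hx.1]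
      have hpos := absDeriv_pos hx.1
      have hle : (M.absDeriv n x)⁻¹ ≤ 2 * Real.exp (n * ρ n) * |u - v| := by
        rw [inv_le_iff_one_le_mul₀ hpos]
        nlinarith [mul_le_mul_of_nonneg_right (hdist n ω z hz x hx.1) huv.le]
      have hlog := Real.log_le_log (inv_pos.2 hpos) hle
      rw [Real.log_inv] at hlog
      linarith [birkhoff_nonneg hφ0 hx.2 n]
    calc _ ≤ ENNReal.ofReal (2 * Real.exp (n * ρ n) * |u - v|) := by
          refine ENNReal.ofReal_le_ofReal ((Real.exp_le_exp.2 hsup).trans_eq ?_)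
          rw [Real.exp_log (by positivity)]
      _ = ENNReal.ofReal (2 * Real.exp (n * ρ n)) * MeasureTheory.volume (uIcc v u) := by
          rw [ENNReal.ofReal_mul (by positivity), Real.volume_interval]
      _ ≤ _ := by
          gcongr
          exact (ordConnected_cylinder ω).uIcc_subset hv.1 hu.1
  have ha : Tendsto (fun n : ℕ => Real.log 2 / n + ρ n) atTop (𝓝 0) := by
    simpa using (tendsto_const_div_atTop_nhds_zero_nat (Real.log 2)).add hρ
  refine pressure_nonpos ha fun n hn => ?_
  have hn' : (n:ℝ) ≠ 0 := by exact_mod_cast hn.ne'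
  have hexp : Real.exp (n * (Real.log 2 / n + ρ n)) = 2 * Real.exp (n * ρ n) := by
    rw [mul_add, mul_div_cancel₀ _ hn', Real.exp_add, Real.exp_log two_pos]
  calc M.partitionSum _ n ≤ ∑' ω : Fin n → A, ENNReal.ofReal (2 * Real.exp (n * ρ n)) *
        MeasureTheory.volume (M.cylinder ω) := ENNReal.tsum_le_tsum (key n)
    _ ≤ ENNReal.ofReal (2 * Real.exp (n * ρ n)) * 1 := by
        rw [ENNReal.tsum_mul_left]
        gcongr
        exact tsum_volume_cylinder_le hn
    _ = _ := by rw [mul_one, hexp]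

lemma pos_of_pressure_nonpos {φ : ℝ → ℝ} (hφ0 : ∀ x ∈ M.repeller, 0 ≤ φ x) {s : ℝ}
    (hs : M.pressure (fun x => -s * (M.psi x + φ x)) ≤ 0) : 0 < s := by
  by_contra! hs0
  obtain ⟨lam, hlam, N, hN⟩ := exists_le_log_absDeriv (M := M)
  obtain ⟨i, j, hij⟩ := M.nontriv
  have hlog := Real.log_pos one_lt_two
  obtain ⟨n, hn, hnN, hn0⟩ := ((eventually_partitionSum_le hs (half_pos hlog)).and
    ((eventually_ge_atTop N).and (eventually_gt_atTop 0))).exists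
  have hone : ∀ ω : Fin n → A, 1 ≤ ENNReal.ofReal
      (Real.exp (M.birkhoffSup (fun x => -s * (M.psi x + φ x)) ω)) := by
    intro ω
    rw [← ENNReal.ofReal_one]
    refine ENNReal.ofReal_le_ofReal (Real.one_le_exp (Real.sSup_nonneg ?_))
    rintro _ ⟨x, hx, rfl⟩
    rw [birkhoff_neg_mul hx.1]
    have h1 := hN n hnN ω x hx.1
    have h2 := birkhoff_nonneg hφ0 hx.2 n
    have h3 : 0 ≤ n * lam := by positivity
    exact mul_nonneg (neg_nonneg.2 hs0) (by linarith)
  have hinj : Function.Injective fun (b : Fin n → Bool) (ν : Fin n) => cond (b ν) i j := by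
    intro b b' h
    ext ν
    have hν := congrFun h ν
    rcases hb : b ν <;> rcases hb' : b' ν <;> simp_all [hij.symm]
  have hge : ENNReal.ofReal (Real.exp (n * Real.log 2)) ≤
      M.partitionSum (fun x => -s * (M.psi x + φ x)) n :=
    calc _ = ∑' _ : Fin n → Bool, (1 : ENNReal) := by
          rw [mul_comm, Real.exp_mul, Real.exp_log two_pos]
          simp [ENNReal.ofReal_pow]
      _ ≤ _ := (ENNReal.tsum_le_tsum fun b => hone _).trans
          (ENNReal.tsum_comp_le_tsum_of_injective hinj _)
  have hle := Real.exp_le_exp.1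
    ((ENNReal.ofReal_le_ofReal_iff (Real.exp_pos _).le).1 (hge.trans hn))
  have hn' : (0:ℝ) < n := by exact_mod_cast hn0
  nlinarith [le_of_mul_le_mul_left hle hn']

lemma edist_le_of_mem_target {φ : ℝ → ℝ} (hφ : M.Tempered φ) {n : ℕ} {ω : Fin n → A} {y C x z : ℝ}
    (hx : x ∈ M.cylinder ω ∩ M.repeller) (hz : z ∈ M.cylinder ω ∩ M.repeller)
    (hC : ∀ w ∈ M.cylinder ω, M.absDeriv n x ≤ Real.exp C * M.absDeriv n w)
    (hxy : |M.T^[n] x - y| < Real.exp (-(M.birkhoff φ n x)))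
    (hzy : |M.T^[n] z - y| < Real.exp (-(M.birkhoff φ n z))) :
    edist x z ≤ ENNReal.ofReal (2 * Real.exp (C + M.var (M.birkhoff φ n) n
      - (Real.log (M.absDeriv n x) + M.birkhoff φ n x))) := by
  rw [edist_dist, Real.dist_eq]
  refine ENNReal.ofReal_le_ofReal ?_
  set V := M.var (M.birkhoff φ n) n
  have hpos := absDeriv_pos hx.1
  have hV := abs_le.1 (abs_birkhoff_sub_le hφ hx hz)
  have hV0 : 0 ≤ V := (abs_nonneg _).trans (abs_birkhoff_sub_le hφ hx hz)
  obtain ⟨w, hw, h⟩ := exists_absDeriv_mul_eq hx.1 hz.1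
  have h1 : |M.T^[n] x - M.T^[n] z| ≤ 2 * Real.exp (V - M.birkhoff φ n x) := by
    have e1 : Real.exp (-(M.birkhoff φ n x)) ≤ Real.exp (V - M.birkhoff φ n x) :=
      Real.exp_le_exp.2 (by linarith)
    have e2 : Real.exp (-(M.birkhoff φ n z)) ≤ Real.exp (V - M.birkhoff φ n x) :=
      Real.exp_le_exp.2 (by linarith)
    have e3 := abs_sub_le (M.T^[n] x) y (M.T^[n] z)
    rw [abs_sub_comm y] at e3
    linarith
  have h2 : |x - z| * M.absDeriv n x ≤ Real.exp C * (2 * Real.exp (V - M.birkhoff φ n x)) := by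
    calc |x - z| * M.absDeriv n x ≤ |x - z| * (Real.exp C * M.absDeriv n w) := by
          gcongr; exact hC w hw
      _ = Real.exp C * |M.T^[n] x - M.T^[n] z| := by rw [h]; ring
      _ ≤ _ := by gcongr
  have h3 : Real.exp (C + V - (Real.log (M.absDeriv n x) + M.birkhoff φ n x)) =
      Real.exp C * Real.exp (V - M.birkhoff φ n x) / M.absDeriv n x := by
    rw [← Real.exp_add, eq_div_iff hpos.ne', ← Real.exp_log hpos, ← Real.exp_add, Real.log_exp]
    ring_nf
  rw [h3, mul_div_assoc', le_div_iff₀ hpos]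
  linarith
lemma dimH_shrinkingTarget_le_of_pressure_nonpos {φ : ℝ → ℝ}
    (hφ0 : ∀ x ∈ M.repeller, 0 ≤ φ x) (hφ : M.Tempered φ) (y : ℝ) {s t : ℝ}
    (hs : M.pressure (fun x => -s * (M.psi x + φ x)) ≤ 0) (hst : s < t) :
    dimH (M.shrinkingTarget y φ) ≤ ENNReal.ofReal t := by
  have hs0 := pos_of_pressure_nonpos hφ0 hs
  have ht0 := hs0.trans hst
  have := M.countable
  obtain ⟨lam, hlam, N, hN⟩ := exists_le_log_absDeriv (M := M)
  obtain ⟨ρ, hρ, hdist⟩ := exists_absDeriv_le (M := M)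
  set ε : ℕ → ℝ := fun n => ρ n + M.var (M.birkhoff φ n) n / n with hε
  have hε0 : Tendsto ε atTop (𝓝 0) := by simpa using hρ.add hφ.2
  set κ : ℝ := (t - s) * lam / 4 with hκ
  have hκ0 : 0 < κ := by
    have := sub_pos.2 hst
    positivity
  let E : ∀ {n : ℕ}, (Fin n → A) → Set ℝ := fun {n} ω =>
    {x | x ∈ M.cylinder ω ∩ M.repeller ∧ |M.T^[n] x - y| < Real.exp (-(M.birkhoff φ n x))}
  obtain ⟨K, hK⟩ : ∃ K : ℕ, ∀ n, K ≤ n → 0 < n ∧ N ≤ n ∧ t * ε n ≤ κ ∧ ε n ≤ lam / 2 ∧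
      M.partitionSum (fun x => -s * (M.psi x + φ x)) n ≤ ENNReal.ofReal (Real.exp (n * κ)) := by
    refine eventually_atTop.1 ?_
    filter_upwards [eventually_gt_atTop 0, eventually_ge_atTop N,
      (hε0.const_mul t).eventually (ge_mem_nhds (by simpa using hκ0)),
      hε0.eventually (ge_mem_nhds (half_pos hlam)), eventually_partitionSum_le hs hκ0]
      with n h1 h2 h3 h4 h5 using ⟨h1, h2, h3, h4, h5⟩
  have hedist : ∀ n, K ≤ n → ∀ ω : Fin n → A, ∀ x ∈ E ω, ∀ z ∈ E ω, edist x z ≤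
      ENNReal.ofReal (2 * Real.exp (n * ε n
        - (Real.log (M.absDeriv n x) + M.birkhoff φ n x))) := by
    intro n hn ω x hx z hz
    have hn0 : (n:ℝ) ≠ 0 := by exact_mod_cast (hK n hn).1.ne'
    have hnε : n * ε n = n * ρ n + M.var (M.birkhoff φ n) n := by
      rw [hε, mul_add, mul_div_cancel₀ _ hn0]
    rw [hnε]
    exact edist_le_of_mem_target hφ hx.1 hz.1 (hdist n ω x hx.1.1) hx.2 hz.2
  have hdiam0 : ∀ n, K ≤ n → ∀ ω : Fin n → A, Metric.ediam (E ω) ≤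
      ENNReal.ofReal (2 * Real.exp (-(n * (lam / 2)))) := by
    intro n hn ω
    refine Metric.ediam_le fun x hx z hz => (hedist n hn ω x hx z hz).trans ?_
    have h1 := hN n (hK n hn).2.1 ω x hx.1.1
    have h2 := birkhoff_nonneg hφ0 hx.1.2 n
    have h3 := mul_le_mul_of_nonneg_left (hK n hn).2.2.2.1 (Nat.cast_nonneg (α := ℝ) n)
    gcongr
    linarith
  have hpow : ∀ n, K ≤ n → ∀ ω : Fin n → A, Metric.ediam (E ω) ^ t ≤
      ENNReal.ofReal (2 ^ t * Real.exp (-(3 * n * κ))) * ENNReal.ofReal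
        (Real.exp (M.birkhoffSup (fun x => -s * (M.psi x + φ x)) ω)) := by
    intro n hn ω
    set B := M.birkhoffSup (fun x => -s * (M.psi x + φ x)) ω
    have hdiam : Metric.ediam (E ω) ≤
        ENNReal.ofReal (2 * Real.exp ((-(3 * n * κ) + B) / t)) := by
      refine Metric.ediam_le fun x hx z hz => (hedist n hn ω x hx z hz).trans ?_
      have h1 := hN n (hK n hn).2.1 ω x hx.1.1
      have h2 := birkhoff_nonneg hφ0 hx.1.2 n
      have h3 := mul_le_mul_of_nonneg_left (hK n hn).2.2.1 (Nat.cast_nonneg (α := ℝ) n)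
      have hB : -s * (Real.log (M.absDeriv n x) + M.birkhoff φ n x) ≤ B := by
        rw [← birkhoff_neg_mul hx.1.1]
        refine le_csSup ⟨0, ?_⟩ ⟨x, hx.1, rfl⟩
        rintro _ ⟨z, hz, rfl⟩
        rw [birkhoff_neg_mul hz.1]
        have h4 := hN n (hK n hn).2.1 ω z hz.1
        have h5 := birkhoff_nonneg hφ0 hz.2 n
        have h6 : 0 ≤ n * lam := by positivity
        exact mul_nonpos_of_nonpos_of_nonneg (neg_nonpos.2 hs0.le) (by linarith)
      have h4 : (t - s) * (n * lam) ≤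
          (t - s) * (Real.log (M.absDeriv n x) + M.birkhoff φ n x) :=
        mul_le_mul_of_nonneg_left (by linarith) (sub_pos.2 hst).le
      have h5 : (t - s) * (n * lam) = 4 * (n * κ) := by rw [hκ]; ring
      gcongr
      rw [le_div_iff₀ ht0]
      linarith
    refine (ENNReal.rpow_le_rpow hdiam ht0.le).trans_eq ?_
    rw [ENNReal.ofReal_rpow_of_pos (by positivity), ← ENNReal.ofReal_mul (by positivity),
      Real.mul_rpow (by norm_num) (Real.exp_pos _).le, ← Real.exp_mul, div_mul_cancel₀ _ ht0.ne',
      mul_assoc (2 ^ t), ← Real.exp_add]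
  have hsum : ∀ n, K ≤ n → ∑' ω : Fin n → A, Metric.ediam (E ω) ^ t ≤
      ENNReal.ofReal (2 ^ t) * ENNReal.ofReal (Real.exp (-(2 * κ))) ^ n := by
    intro n hn
    calc _ ≤ ∑' ω : Fin n → A, ENNReal.ofReal (2 ^ t * Real.exp (-(3 * n * κ))) *
            ENNReal.ofReal (Real.exp (M.birkhoffSup (fun x => -s * (M.psi x + φ x)) ω)) :=
          ENNReal.tsum_le_tsum (hpow n hn)
      _ ≤ ENNReal.ofReal (2 ^ t * Real.exp (-(3 * n * κ))) * ENNReal.ofReal (Real.exp (n * κ)) := by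
          rw [ENNReal.tsum_mul_left]
          gcongr
          exact (hK n hn).2.2.2.2
      _ = _ := by
          rw [← ENNReal.ofReal_mul (by positivity), mul_assoc, ← Real.exp_add,
            ENNReal.ofReal_mul (by positivity), ← ENNReal.ofReal_pow (Real.exp_pos _).le,
            ← Real.exp_nat_mul]
          ring_nf
  have hq : ENNReal.ofReal (Real.exp (-(2 * κ))) < 1 := by
    rw [ENNReal.ofReal_lt_one, Real.exp_lt_one_iff]
    linarith
  have hr : Tendsto (fun m : ℕ => ENNReal.ofReal (2 * Real.exp (-(m * (lam / 2))))) atTop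
      (𝓝 0) := by
    have h : Tendsto (fun m : ℕ => (m:ℝ) * (lam / 2)) atTop atTop :=
      tendsto_natCast_atTop_atTop.atTop_mul_const (half_pos hlam)
    simpa using ENNReal.tendsto_ofReal
      ((Real.tendsto_exp_atBot.comp (tendsto_neg_atTop_atBot.comp h)).const_mul 2)
  have hmeas := MeasureTheory.Measure.hausdorffMeasure_le_liminf_tsum
    (ι := fun m : ℕ => Σ k : ℕ, (Fin (m + k) → A)) t
    (M.shrinkingTarget y φ) _ hr (fun m i => E i.2)
    ((eventually_ge_atTop K).mono fun m hm i => by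
      refine (hdiam0 _ (hm.trans (Nat.le_add_right m i.1)) i.2).trans ?_
      gcongr
      exact_mod_cast Nat.le_add_right m i.1)
    (Eventually.of_forall fun m x hx => by
      obtain ⟨n, hmn, hxR, hxy⟩ : ∃ n, m ≤ n ∧ x ∈ M.repeller ∧
          |M.T^[n] x - y| < Real.exp (-(M.birkhoff φ n x)) := by
        simpa [and_left_comm] using mem_iInter.1 hx m
      obtain ⟨k, rfl⟩ := Nat.exists_eq_add_of_le hmn
      obtain ⟨ω, hω⟩ := exists_mem_cylinder_of_mem_repeller hxR (m + k)
      exact mem_iUnion.2 ⟨⟨k, ω⟩, ⟨hω, hxR⟩, hxy⟩)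
  refine dimH_le_of_hausdorffMeasure_ne_top (d := t.toNNReal) ?_
  rw [Real.coe_toNNReal t ht0.le]
  have hfin : ENNReal.ofReal (2 ^ t) *
      ∑' k : ℕ, ENNReal.ofReal (Real.exp (-(2 * κ))) ^ k ≠ ⊤ :=
    ENNReal.mul_ne_top ENNReal.ofReal_ne_top (tsum_geometric_lt_top.2 hq).ne
  refine ne_top_of_le_ne_top hfin (hmeas.trans ((liminf_le_limsup).trans
    (limsup_le_of_le (h := (eventually_ge_atTop K).mono fun m hm => ?_))))
  rw [ENNReal.tsum_sigma' (fun i : Σ k : ℕ, (Fin (m + k) → A) => Metric.ediam (E i.2) ^ t),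
    ← ENNReal.tsum_mul_left]
  refine ENNReal.tsum_le_tsum fun k => (hsum _ (hm.trans (Nat.le_add_right m k))).trans ?_
  gcongr _ * ?_
  exact pow_le_pow_right_of_le_one' hq.le (Nat.le_add_left k m)

end ExpandingMarkovMap

/-- **Upper bound.** For an expanding Markov map `T` with repeller `Λ` and a non-negative
potential `φ` satisfying the tempered distortion condition, for every `y ∈ [0,1]`,
`dim D_y(φ) ≤ s(φ)`. -/
theorem dimH_shrinkingTarget_le {A : Type} (M : ExpandingMarkovMap A)
    (φ : ℝ → ℝ) (hφ0 : ∀ x ∈ M.repeller, 0 ≤ φ x) (hφ : M.Tempered φ)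
    (y : ℝ) (hy : y ∈ Set.Icc (0:ℝ) 1) :
    dimH (M.shrinkingTarget y φ) ≤ ENNReal.ofReal (M.sdim φ) := by
  have hlim : Tendsto ENNReal.ofReal (𝓝[>] (M.sdim φ)) (𝓝 (ENNReal.ofReal (M.sdim φ))) :=
    ENNReal.continuous_ofReal.continuousWithinAt
  refine ge_of_tendsto hlim (eventually_mem_nhdsWithin.mono fun t ht => ?_)
  obtain ⟨s, hs, hst⟩ := exists_lt_of_csInf_lt
    ⟨1, ExpandingMarkovMap.pressure_neg_one_nonpos hφ0⟩
    (show sInf {s : ℝ | M.pressure (fun x => -s * (M.psi x + φ x)) ≤ 0} < t from ht)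
  exact ExpandingMarkovMap.dimH_shrinkingTarget_le_of_pressure_nonpos hφ0 hφ y hs hst
end

section
/- Let Φ : ℕ → ℝ_{>0} be any strictly decreasing function with lim_{n→∞} Φ(n) = 0, and let β ∈ (0,1). Then there exists an expanding Markov map T with repeller Λ such that dim Λ = β, together with a point y ∈ closure(Λ), such that dim S_y(Φ) = 0. -/
open Set Filter Topology

/-- Placement data for countably many closed intervals `[a i, a i + r i] ⊆ [0,1]`, ordered from
right to left and accumulating only at `0`. The lengths satisfy the Moran equation
`∑ r i ^ β = 1`, and the gap to the left of the `i`-th interval is at least `c * r i`. -/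
structure GapSystem (β : ℝ) where
  r : ℕ → ℝ
  a : ℕ → ℝ
  c : ℝ
  r_pos : ∀ i, 0 < r i
  r_le_half : ∀ i, r i ≤ 1 / 2
  a_nonneg : ∀ i, 0 ≤ a i
  top_le_one : a 0 + r 0 ≤ 1
  c_pos : 0 < c
  gap : ∀ i, a (i + 1) + r (i + 1) + c * r i ≤ a i
  a_lim : Tendsto a atTop (𝓝 0)
  hasSum : HasSum (fun i => r i ^ β) 1
  tail : ∀ i, ∑' k, r (k + i) ^ β ≤ 3 * r i ^ β

namespace GapSystem

variable {β : ℝ} (G : GapSystem β)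

/-- The `i`-th interval. -/
def V (i : ℕ) : Set ℝ := Icc (G.a i) (G.a i + G.r i)

lemma top_add_gap_le {i j : ℕ} (hij : i < j) : G.a j + G.r j + G.c * G.r i ≤ G.a i := by
  induction j, hij using Nat.le_induction with
  | base => exact G.gap i
  | succ j _ ih =>
    have h1 := G.gap j
    have h2 := mul_pos G.c_pos (G.r_pos j)
    have h3 := G.r_pos j
    linarith

lemma top_lt {i j : ℕ} (hij : i < j) : G.a j + G.r j < G.a i := by
  have := G.top_add_gap_le hij
  have := mul_pos G.c_pos (G.r_pos i)
  linarith

lemma right_endpoint_le_one (i : ℕ) : G.a i + G.r i ≤ 1 := by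
  rcases Nat.eq_zero_or_pos i with rfl | hi
  · exact G.top_le_one
  · have := G.top_lt hi
    have := G.top_le_one
    have := G.r_pos 0
    linarith

lemma eq_of_mem_V {i j : ℕ} {x : ℝ} (hi : x ∈ G.V i) (hj : x ∈ G.V j) : i = j := by
  rcases lt_trichotomy i j with h | h | h
  · have := G.top_lt h
    linarith [hi.1, hj.2]
  · exact h
  · have := G.top_lt h
    linarith [hj.1, hi.2]

open Classical in
/-- The index of the interval containing `x` (or `0` if there is none). -/
noncomputable def index (x : ℝ) : ℕ := if h : ∃ i, x ∈ G.V i then h.choose else 0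

lemma index_eq {i : ℕ} {x : ℝ} (h : x ∈ G.V i) : G.index x = i := by
  have hex : ∃ i, x ∈ G.V i := ⟨i, h⟩
  rw [index, dif_pos hex]
  exact G.eq_of_mem_V hex.choose_spec h

/-- The piecewise affine map sending each interval onto `[0,1]`. -/
noncomputable def T (x : ℝ) : ℝ := (x - G.a (G.index x)) / G.r (G.index x)

/-- The derivative of the piecewise affine map. -/
noncomputable def T' (x : ℝ) : ℝ := 1 / G.r (G.index x)

lemma T_eq {i : ℕ} {x : ℝ} (h : x ∈ G.V i) : G.T x = (x - G.a i) / G.r i := by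
  rw [T, G.index_eq h]

lemma T'_eq {i : ℕ} {x : ℝ} (h : x ∈ G.V i) : G.T' x = 1 / G.r i := by
  rw [T', G.index_eq h]

lemma two_le_T' (x : ℝ) : 2 ≤ |G.T' x| := by
  have h := G.r_pos (G.index x)
  rw [T', abs_of_pos (by positivity), le_div_iff₀ h]
  linarith [G.r_le_half (G.index x)]

lemma prod_T'_pos (n : ℕ) (x : ℝ) : 0 < ∏ l ∈ Finset.range n, |G.T' (G.T^[l] x)| :=
  Finset.prod_pos fun _ _ => two_pos.trans_le (G.two_le_T' _)

lemma T_mem_Icc {i : ℕ} {x : ℝ} (h : x ∈ G.V i) : G.T x ∈ Icc (0 : ℝ) 1 := by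
  have hr := G.r_pos i
  rw [G.T_eq h]
  exact ⟨div_nonneg (by linarith [h.1]) hr.le, (div_le_one hr).2 (by linarith [h.2])⟩

/-- The expanding Markov map given by the piecewise affine map. -/
noncomputable def toMarkov : ExpandingMarkovMap ℕ where
  countable := inferInstance
  nontriv := ⟨0, 1, by norm_num⟩
  V := G.V
  T := G.T
  T' := G.T'
  V_subset i := fun x hx => ⟨(G.a_nonneg i).trans hx.1, hx.2.trans (G.right_endpoint_le_one i)⟩
  V_ordConnected i := ordConnected_Icc
  V_interior_nonempty i := by
    rw [V, interior_Icc]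
    exact nonempty_Ioo.2 (by linarith [G.r_pos i])
  V_disjoint := fun i j hij => Set.disjoint_left.2 fun x hi hj => hij (G.eq_of_mem_V hi hj)
  T_mapsTo i := fun x hx => G.T_mem_Icc hx
  T_C1 i := by
    refine ContDiffOn.congr (f := fun x => (x - G.a i) / G.r i) ?_ fun x hx => G.T_eq hx
    fun_prop
  T_hasDeriv i x hx := by
    rw [G.T'_eq hx]
    exact (((hasDerivAt_id x).sub_const (G.a i)).div_const (G.r i)).hasDerivWithinAt.congr
      (fun y hy => G.T_eq hy) (G.T_eq hx)
  T_maps_interior i := by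
    have hr := G.r_pos i
    rw [V, interior_Icc]
    ext y
    constructor
    · rintro ⟨x, hx, rfl⟩
      rw [G.T_eq (Ioo_subset_Icc_self hx)]
      exact ⟨div_pos (by linarith [hx.1]) hr, (div_lt_one hr).2 (by linarith [hx.2])⟩
    · rintro ⟨h0, h1⟩
      have hx : G.a i + G.r i * y ∈ Ioo (G.a i) (G.a i + G.r i) :=
        ⟨by nlinarith, by nlinarith⟩
      refine ⟨_, hx, ?_⟩
      rw [G.T_eq (Ioo_subset_Icc_self hx)]
      field_simp
      ring
  expanding := by
    refine ⟨3 / 2, by norm_num, 1, fun n hn ω x _ => ?_⟩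
    calc (3 / 2 : ℝ) ^ n < 2 ^ n := pow_lt_pow_left₀ (by norm_num) (by norm_num) (by omega)
      _ = ∏ l ∈ Finset.range n, (2 : ℝ) := by simp
      _ ≤ _ := Finset.prod_le_prod (fun _ _ => by norm_num) fun l _ => G.two_le_T' _
  distortion := by
    refine ⟨fun _ => 0, tendsto_const_nhds, fun n ω x y hx hy => ?_⟩
    have h : ∏ l ∈ Finset.range n, |G.T' (G.T^[l] x)| = ∏ l ∈ Finset.range n, |G.T' (G.T^[l] y)| :=
      Finset.prod_congr rfl fun l hl => by
        rw [G.T'_eq (hx ⟨l, Finset.mem_range.1 hl⟩), G.T'_eq (hy ⟨l, Finset.mem_range.1 hl⟩)]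
    rw [h, div_self (G.prod_T'_pos n y).ne']
    simp

lemma repeller_subset : G.toMarkov.repeller ⊆ Icc (0 : ℝ) 1 := fun x hx => by
  obtain ⟨i, hi⟩ := mem_iUnion.1 (hx 0)
  exact G.toMarkov.V_subset i hi

lemma iterate_mem_repeller {x : ℝ} (hx : x ∈ G.toMarkov.repeller) (n : ℕ) :
    G.T^[n] x ∈ G.toMarkov.repeller := fun k => by
  change G.T^[k] (G.T^[n] x) ∈ _
  rw [← Function.iterate_add_apply]
  exact hx (k + n)

lemma abs_sub_eq {i : ℕ} {x y : ℝ} (hx : x ∈ G.V i) (hy : y ∈ G.V i) :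
    |x - y| = G.r i * |G.T x - G.T y| := by
  have hr := G.r_pos i
  rw [G.T_eq hx, G.T_eq hy, ← sub_div, abs_div, abs_of_pos hr, mul_div_cancel₀ _ hr.ne']
  congr 1
  ring

lemma abs_sub_eq_prod {n : ℕ} {ω : Fin n → ℕ} {x y : ℝ} (hx : x ∈ G.toMarkov.cylinder ω)
    (hy : y ∈ G.toMarkov.cylinder ω) :
    |x - y| = (∏ i, G.r (ω i)) * |G.T^[n] x - G.T^[n] y| := by
  induction n with
  | zero => simp
  | succ n ih =>
    have h : |G.T^[n] x - G.T^[n] y| = _ :=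
      G.abs_sub_eq (hx (Fin.last n)) (hy (Fin.last n))
    rw [ih (ω := fun i => ω i.castSucc) (fun i => hx i.castSucc) (fun i => hy i.castSucc), h,
      Fin.prod_univ_castSucc, mul_assoc, Function.iterate_succ_apply', Function.iterate_succ_apply']

lemma ediam_le_prod {n : ℕ} (ω : Fin n → ℕ) :
    Metric.ediam (G.toMarkov.cylinder ω ∩ G.toMarkov.repeller) ≤
      ∏ i, ENNReal.ofReal (G.r (ω i)) := by
  refine Metric.ediam_le fun x hx y hy => ?_
  rw [← ENNReal.ofReal_prod_of_nonneg fun i _ => (G.r_pos _).le, edist_dist, Real.dist_eq,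
    G.abs_sub_eq_prod hx.1 hy.1]
  refine ENNReal.ofReal_le_ofReal (mul_le_of_le_one_right ?_ ?_)
  · exact Finset.prod_nonneg fun i _ => (G.r_pos _).le
  · have h1 := G.repeller_subset (G.iterate_mem_repeller hx.2 n)
    have h2 := G.repeller_subset (G.iterate_mem_repeller hy.2 n)
    rw [abs_le]
    constructor <;> linarith [h1.1, h1.2, h2.1, h2.2]

lemma prod_le_half_pow {n : ℕ} (ω : Fin n → ℕ) :
    ∏ i, ENNReal.ofReal (G.r (ω i)) ≤ (1 / 2) ^ n := by
  calc ∏ i, ENNReal.ofReal (G.r (ω i)) ≤ ∏ _i : Fin n, (1 / 2 : ENNReal) :=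
        Finset.prod_le_prod' fun i _ => by
          refine (ENNReal.ofReal_le_ofReal (G.r_le_half _)).trans_eq ?_
          rw [ENNReal.ofReal_div_of_pos two_pos]
          simp
    _ = _ := by simp

lemma tendsto_half_pow_ennreal : Tendsto (fun n : ℕ => (1 / 2 : ENNReal) ^ n) atTop (𝓝 0) :=
  ENNReal.tendsto_pow_atTop_nhds_zero_of_lt_one (by norm_num)

lemma tsum_prod_eq_pow (f : ℕ → ENNReal) (n : ℕ) :
    ∑' ω : Fin n → ℕ, ∏ i, f (ω i) = (∑' k, f k) ^ n := by
  induction n with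
  | zero => simp
  | succ n ih =>
    rw [← (Fin.consEquiv fun _ => ℕ).tsum_eq, ENNReal.tsum_prod', pow_succ', ← ih,
      ← ENNReal.tsum_mul_right]
    refine tsum_congr fun k => ?_
    rw [← ENNReal.tsum_mul_left]
    exact tsum_congr fun ω => by simp [Fin.consEquiv, Fin.prod_univ_succ]

lemma exists_mem_cylinder {x : ℝ} (hx : x ∈ G.toMarkov.repeller) (n : ℕ) :
    ∃ ω : Fin n → ℕ, x ∈ G.toMarkov.cylinder ω := by
  choose d hd using fun k => mem_iUnion.1 (hx k)
  exact ⟨fun i => d i, fun i => hd i⟩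

/-- The repeller has dimension at most `β`, by covering it with cylinders. -/
lemma dimH_repeller_le (hβ : 0 < β) : dimH G.toMarkov.repeller ≤ ENNReal.ofReal β := by
  refine dimH_le_of_hausdorffMeasure_ne_top (d := β.toNNReal) (ne_top_of_le_ne_top
    ENNReal.one_ne_top ?_)
  rw [Real.coe_toNNReal _ hβ.le]
  refine (MeasureTheory.Measure.hausdorffMeasure_le_liminf_tsum (ι := fun n : ℕ => Fin n → ℕ) β _
    (l := atTop) (fun n => (1 / 2) ^ n) tendsto_half_pow_ennreal
    (fun n ω => G.toMarkov.cylinder ω ∩ G.toMarkov.repeller)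
    (Eventually.of_forall fun n ω => (G.ediam_le_prod ω).trans (G.prod_le_half_pow ω))
    (Eventually.of_forall fun n x hx => ?_)).trans ?_
  · obtain ⟨ω, hω⟩ := G.exists_mem_cylinder hx n
    exact mem_iUnion.2 ⟨ω, hω, hx⟩
  · refine liminf_le_of_le (by isBoundedDefault) fun b hb => ?_
    obtain ⟨n, hn⟩ := hb.exists
    refine hn.trans ?_
    have hs : ∑' k, ENNReal.ofReal (G.r k ^ β) = 1 := by
      rw [← ENNReal.ofReal_tsum_of_nonneg (fun k => Real.rpow_nonneg (G.r_pos k).le β)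
        G.hasSum.summable, G.hasSum.tsum_eq, ENNReal.ofReal_one]
    calc ∑' ω : Fin n → ℕ, Metric.ediam (G.toMarkov.cylinder ω ∩ G.toMarkov.repeller) ^ β
        ≤ ∑' ω : Fin n → ℕ, ∏ i, ENNReal.ofReal (G.r (ω i) ^ β) := by
          refine ENNReal.tsum_le_tsum fun ω => ?_
          refine (ENNReal.rpow_le_rpow (G.ediam_le_prod ω) hβ.le).trans_eq ?_
          rw [← ENNReal.prod_rpow_of_nonneg hβ.le]
          exact Finset.prod_congr rfl fun i _ => ENNReal.ofReal_rpow_of_pos (G.r_pos _)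
      _ = 1 := by rw [tsum_prod_eq_pow fun k => ENNReal.ofReal (G.r k ^ β), hs, one_pow]

lemma tsum_snoc_indicator (w : ℕ → ENNReal) (p : ℕ → Prop) [DecidablePred p] (n : ℕ) :
    ∑' τ : Fin (n + 1) → ℕ, (if p (τ (Fin.last n)) then ∏ i, w (τ i) else 0) =
      (∑' k, w k) ^ n * ∑' k, if p k then w k else 0 := by
  rw [← (Fin.snocEquiv fun _ => ℕ).tsum_eq, ENNReal.tsum_prod', ← tsum_prod_eq_pow,
    ENNReal.tsum_comm, ← ENNReal.tsum_mul_right]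
  refine tsum_congr fun ω => ?_
  rw [← ENNReal.tsum_mul_left]
  exact tsum_congr fun k => by
    by_cases hk : p k <;> simp [Fin.snocEquiv, Fin.prod_univ_castSucc, hk]

lemma tsum_pow_mul_tsum_ne_top {w : ℕ → ENNReal} (hw : ∀ D : ENNReal, D ≠ ⊤ → ∑' k, w k * D ^ k ≠ ⊤)
    (M : ℕ) : ∑' n : ℕ, (∑' k, w k) ^ n * ∑' k, (if n ≤ k + M then w k else 0) ≠ ⊤ := by
  have hC : ∑' k, w k ≠ ⊤ := by simpa using hw 1 ENNReal.one_ne_top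
  set C := ∑' k, w k
  set D := max (2 * C) 1
  have hD : D ≠ ⊤ := max_ne_top (ENNReal.mul_ne_top ENNReal.ofNat_ne_top hC) ENNReal.one_ne_top
  have hle : ∀ n : ℕ, C ^ n * ∑' k, (if n ≤ k + M then w k else 0) ≤
      2⁻¹ ^ n * (D ^ M * ∑' k, w k * D ^ k) := fun n => by
    rw [← ENNReal.tsum_mul_left, ← ENNReal.tsum_mul_left, ← ENNReal.tsum_mul_left]
    refine ENNReal.tsum_le_tsum fun k => ?_
    split_ifs with hk
    · have h1 : C ^ n = 2⁻¹ ^ n * (2 * C) ^ n := by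
        rw [← mul_pow, ← mul_assoc, ENNReal.inv_mul_cancel two_ne_zero ENNReal.ofNat_ne_top,
          one_mul]
      have h2 : (2 * C) ^ n ≤ D ^ (k + M) :=
        (pow_le_pow_left' (le_max_left _ _) n).trans (pow_le_pow_right₀ (le_max_right _ _) hk)
      calc C ^ n * w k ≤ 2⁻¹ ^ n * D ^ (k + M) * w k := by rw [h1]; gcongr
        _ = _ := by rw [pow_add]; ring
    · simp
  refine ne_top_of_le_ne_top ?_ (ENNReal.tsum_le_tsum hle)
  rw [ENNReal.tsum_mul_right, ENNReal.tsum_geometric]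
  refine ENNReal.mul_ne_top ?_ (ENNReal.mul_ne_top (ENNReal.pow_ne_top hD) (hw D hD))
  simp

lemma le_of_mem_V_of_lt {Φ : ℕ → ℝ} (hΦ : Antitone Φ) {M : ℕ} (ha : ∀ i, Φ (i + M) ≤ G.a i)
    {n k : ℕ} {x : ℝ} (hx : x ∈ G.V k) (hlt : |x - 0| < Φ n) : n ≤ k + M := by
  by_contra! h
  have h1 := hΦ h.le
  have h2 := ha k
  rw [sub_zero] at hlt
  linarith [le_abs_self x, hx.1]

/-- If the lengths decay superexponentially and the `i`-th interval lies to the right of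
`Φ (i + M)`, then the orbit can enter `(-Φ n, Φ n)` at time `n` only through intervals of
negligible length, so the shrinking target set at `0` has dimension zero. -/
lemma dimH_shrinkingTargetSeq {Φ : ℕ → ℝ} (hΦ : Antitone Φ) {M : ℕ}
    (ha : ∀ i, Φ (i + M) ≤ G.a i)
    (hdecay : ∀ s : ℝ, 0 < s → ∀ D : ℝ, 0 ≤ D → Summable fun k => G.r k ^ s * D ^ k) :
    dimH (G.toMarkov.shrinkingTargetSeq 0 Φ) = 0 := by
  have key : ∀ s : NNReal, 0 < s → dimH (G.toMarkov.shrinkingTargetSeq 0 Φ) ≤ s := by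
    intro s hs
    have hs' : (0 : ℝ) < s := hs
    set w : ℕ → ENNReal := fun k => ENNReal.ofReal (G.r k) ^ (s : ℝ)
    have hw : ∀ D : ENNReal, D ≠ ⊤ → ∑' k, w k * D ^ k ≠ ⊤ := fun D hD => by
      convert (hdecay s hs' D.toReal ENNReal.toReal_nonneg).tsum_ofReal_ne_top using 3 with k
      rw [ENNReal.ofReal_mul (Real.rpow_nonneg (G.r_pos k).le _), ENNReal.ofReal_pow
        ENNReal.toReal_nonneg, ENNReal.ofReal_toReal hD,
        ← ENNReal.ofReal_rpow_of_pos (G.r_pos k)]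
    refine dimH_le_of_hausdorffMeasure_ne_top (ne_top_of_le_ne_top
      (tsum_pow_mul_tsum_ne_top hw M) ?_)
    classical
    let E : ℕ → (Σ n : ℕ, Fin (n + 1) → ℕ) → Set ℝ := fun m τ =>
      if m ≤ τ.1 ∧ τ.1 ≤ τ.2 (Fin.last τ.1) + M then
        G.toMarkov.cylinder τ.2 ∩ G.toMarkov.repeller else ∅
    refine (MeasureTheory.Measure.hausdorffMeasure_le_liminf_tsum
      (ι := fun _ : ℕ => Σ n : ℕ, Fin (n + 1) → ℕ) s _
      (l := atTop) (fun n => (1 / 2) ^ n) tendsto_half_pow_ennreal E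
      (Eventually.of_forall fun m τ => ?_) (Eventually.of_forall fun m x hx => ?_)).trans ?_
    · by_cases h : m ≤ τ.1 ∧ τ.1 ≤ τ.2 (Fin.last τ.1) + M
      · simp only [E, if_pos h]
        refine (G.ediam_le_prod τ.2).trans ((G.prod_le_half_pow τ.2).trans ?_)
        exact pow_le_pow_right_of_le_one' (by norm_num) (h.1.trans (Nat.le_succ _))
      · simp [E, if_neg h]
    · obtain ⟨n, hn⟩ := mem_iUnion.1 (mem_iInter.1 hx m)
      obtain ⟨hmn, hxΛ, hlt⟩ := mem_iUnion.1 hn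
      obtain ⟨τ, hτ⟩ := G.exists_mem_cylinder hxΛ (n + 1)
      refine mem_iUnion.2 ⟨⟨n, τ⟩, ?_⟩
      simp only [E]
      rw [if_pos ⟨hmn, G.le_of_mem_V_of_lt hΦ ha (hτ (Fin.last n)) hlt⟩]
      exact ⟨hτ, hxΛ⟩
    · refine liminf_le_of_le (by isBoundedDefault) fun b hb => ?_
      obtain ⟨m, hm⟩ := hb.exists
      refine hm.trans ?_
      rw [ENNReal.tsum_sigma']
      refine ENNReal.tsum_le_tsum fun n => ?_
      rw [← tsum_snoc_indicator w fun k => n ≤ k + M]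
      refine ENNReal.tsum_le_tsum fun τ => ?_
      by_cases h : n ≤ τ (Fin.last n) + M
      · rw [if_pos h, ENNReal.prod_rpow_of_nonneg hs'.le]
        refine ENNReal.rpow_le_rpow (le_trans (Metric.ediam_mono ?_) (G.ediam_le_prod τ)) hs'.le
        simp only [E]
        split_ifs
        · exact subset_rfl
        · exact empty_subset _
      · simp [E, h, hs']
  refine le_antisymm (ENNReal.le_of_forall_pos_le_add fun s hs _ => ?_) zero_le
  simpa using key s hs

/-- The total mass `∑_{k ≥ i} r k ^ β` of the intervals with index at least `i`. -/
noncomputable def tailMass (i : ℕ) : ℝ := ∑' k, G.r (k + i) ^ β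

lemma tailMass_zero : G.tailMass 0 = 1 := by simpa [tailMass] using G.hasSum.tsum_eq

lemma tailMass_eq (i : ℕ) : G.tailMass i = G.r i ^ β + G.tailMass (i + 1) := by
  have h : Summable fun k => G.r (k + i) ^ β :=
    (summable_nat_add_iff (f := fun k => G.r k ^ β) i).2 G.hasSum.summable
  rw [tailMass, h.tsum_eq_zero_add, zero_add, tailMass]
  simp only [add_assoc, add_comm 1 i]

lemma tailMass_nonneg (i : ℕ) : 0 ≤ G.tailMass i :=
  tsum_nonneg fun _ => Real.rpow_nonneg (G.r_pos _).le _

lemma tailMass_antitone : Antitone G.tailMass := antitone_nat_of_succ_le fun i => by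
  rw [G.tailMass_eq i]
  exact le_add_of_nonneg_left (Real.rpow_nonneg (G.r_pos _).le _)

lemma exists_tailMass_lt {t : ℝ} (ht : 0 < t) : ∃ i, G.tailMass (i + 1) < t := by
  have h : Tendsto G.tailMass atTop (𝓝 0) := tendsto_sum_nat_add fun k => G.r k ^ β
  exact ((h.comp (tendsto_add_atTop_nat 1)).eventually_lt_const ht).exists

open Classical in
/-- The first digit of `t` in the expansion of `(0,1]` with weights `r i ^ β`. -/
noncomputable def digit (t : ℝ) : ℕ :=
  if h : ∃ i, G.tailMass (i + 1) < t then Nat.find h else 0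

/-- The remainder of `t` after removing its first digit. -/
noncomputable def next (t : ℝ) : ℝ := (t - G.tailMass (G.digit t + 1)) / G.r (G.digit t) ^ β

lemma tailMass_digit_lt {t : ℝ} (ht : t ∈ Ioc (0 : ℝ) 1) : G.tailMass (G.digit t + 1) < t := by
  classical
  have h := G.exists_tailMass_lt ht.1
  rw [digit, dif_pos h]
  exact Nat.find_spec h

lemma le_tailMass_digit {t : ℝ} (ht : t ∈ Ioc (0 : ℝ) 1) : t ≤ G.tailMass (G.digit t) := by
  classical
  have h := G.exists_tailMass_lt ht.1
  rw [digit, dif_pos h]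
  rcases hk : Nat.find h with _ | k
  · rw [G.tailMass_zero]
    exact ht.2
  · exact not_lt.1 (Nat.find_min h (m := k) (by omega))

lemma eq_add_next (t : ℝ) :
    t = G.tailMass (G.digit t + 1) + G.r (G.digit t) ^ β * G.next t := by
  have := (Real.rpow_pos_of_pos (G.r_pos (G.digit t)) β).ne'
  rw [next]
  field_simp
  ring

lemma next_mem {t : ℝ} (ht : t ∈ Ioc (0 : ℝ) 1) : G.next t ∈ Ioc (0 : ℝ) 1 := by
  have hp := Real.rpow_pos_of_pos (G.r_pos (G.digit t)) β
  have h1 := G.tailMass_digit_lt ht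
  have h2 := G.le_tailMass_digit ht
  rw [G.tailMass_eq] at h2
  exact ⟨div_pos (by linarith) hp, (div_le_one hp).2 (by linarith)⟩

/-- The `n`-th term in the expansion of the point with digit sequence `d`. -/
noncomputable def codeTerm (d : ℕ → ℕ) (n : ℕ) : ℝ :=
  (∏ k ∈ Finset.range n, G.r (d k)) * G.a (d n)

lemma prod_r_nonneg (d : ℕ → ℕ) (n : ℕ) : 0 ≤ ∏ k ∈ Finset.range n, G.r (d k) :=
  Finset.prod_nonneg fun _ _ => (G.r_pos _).le

lemma codeTerm_nonneg (d : ℕ → ℕ) (n : ℕ) : 0 ≤ G.codeTerm d n :=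
  mul_nonneg (G.prod_r_nonneg d n) (G.a_nonneg _)

lemma sum_codeTerm_add_prod_le (d : ℕ → ℕ) (n : ℕ) :
    ∑ k ∈ Finset.range n, G.codeTerm d k + ∏ k ∈ Finset.range n, G.r (d k) ≤ 1 := by
  induction n with
  | zero => simp
  | succ n ih =>
    have h := mul_le_mul_of_nonneg_left (G.right_endpoint_le_one (d n)) (G.prod_r_nonneg d n)
    rw [Finset.sum_range_succ, Finset.prod_range_succ, codeTerm]
    linarith

lemma sum_codeTerm_le_one (d : ℕ → ℕ) (n : ℕ) : ∑ k ∈ Finset.range n, G.codeTerm d k ≤ 1 := by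
  linarith [G.sum_codeTerm_add_prod_le d n, G.prod_r_nonneg d n]

lemma summable_codeTerm (d : ℕ → ℕ) : Summable (G.codeTerm d) :=
  summable_of_sum_range_le (G.codeTerm_nonneg d) (G.sum_codeTerm_le_one d)

/-- The point of `[0,1]` with digit sequence `d`. -/
noncomputable def code (d : ℕ → ℕ) : ℝ := ∑' n, G.codeTerm d n

lemma code_mem_Icc (d : ℕ → ℕ) : G.code d ∈ Icc (0 : ℝ) 1 :=
  ⟨tsum_nonneg (G.codeTerm_nonneg d),
    Real.tsum_le_of_sum_range_le (G.codeTerm_nonneg d) (G.sum_codeTerm_le_one d)⟩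

lemma code_eq (d : ℕ → ℕ) : G.code d = G.a (d 0) + G.r (d 0) * G.code fun n => d (n + 1) := by
  rw [code, (G.summable_codeTerm d).tsum_eq_zero_add, code, ← tsum_mul_left]
  congr 1
  · simp [codeTerm]
  · exact tsum_congr fun n => by
      rw [codeTerm, codeTerm, Finset.prod_range_succ', mul_comm _ (G.r (d 0)), mul_assoc]

/-- The point of the repeller whose itinerary is the digit expansion of `t`. -/
noncomputable def lift (t : ℝ) : ℝ := G.code fun n => G.digit (G.next^[n] t)

lemma lift_mem_Icc (t : ℝ) : G.lift t ∈ Icc (0 : ℝ) 1 := G.code_mem_Icc _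

lemma lift_eq (t : ℝ) : G.lift t = G.a (G.digit t) + G.r (G.digit t) * G.lift (G.next t) :=
  G.code_eq _

lemma lift_mem_V (t : ℝ) : G.lift t ∈ G.V (G.digit t) := by
  have h := G.lift_mem_Icc (G.next t)
  have hr := G.r_pos (G.digit t)
  rw [G.lift_eq]
  exact ⟨by nlinarith [h.1], by nlinarith [h.2]⟩

lemma T_lift (t : ℝ) : G.T (G.lift t) = G.lift (G.next t) := by
  have hr := (G.r_pos (G.digit t)).ne'
  rw [G.T_eq (G.lift_mem_V t), G.lift_eq]
  field_simp
  ring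

lemma lift_mem_repeller (t : ℝ) : G.lift t ∈ G.toMarkov.repeller := fun n => by
  have h : Function.Semiconj G.lift G.next G.T := fun t => (G.T_lift t).symm
  change G.T^[n] (G.lift t) ∈ _
  rw [← (h.iterate_right n).eq t]
  exact mem_iUnion.2 ⟨_, G.lift_mem_V _⟩

lemma abs_sub_le_of_digit_lt (hβ : 0 < β) {s t : ℝ} (hs : s ∈ Ioc (0 : ℝ) 1)
    (ht : t ∈ Ioc (0 : ℝ) 1) (h : G.digit s < G.digit t) :
    |s - t| * G.c ^ β ≤ 3 * |G.lift s - G.lift t| ^ β := by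
  have h1 : |s - t| ≤ 3 * G.r (G.digit s) ^ β := by
    refine le_trans ?_ (G.tail (G.digit s))
    change _ ≤ G.tailMass (G.digit s)
    have h2 := G.tailMass_digit_lt hs
    have h3 := G.le_tailMass_digit hs
    have h4 := G.le_tailMass_digit ht
    have h5 := G.tailMass_antitone (Nat.succ_le_of_lt h)
    have h6 := ht.1
    rw [Nat.succ_eq_add_one] at h5
    rw [abs_le]
    constructor <;> linarith
  have h2 : G.c * G.r (G.digit s) ≤ |G.lift s - G.lift t| := by
    have h3 := (G.lift_mem_V s).1
    have h4 := (G.lift_mem_V t).2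
    have h5 := G.top_add_gap_le h
    exact le_trans (by linarith) (le_abs_self _)
  calc |s - t| * G.c ^ β ≤ 3 * G.r (G.digit s) ^ β * G.c ^ β := by
        gcongr
        exact Real.rpow_nonneg G.c_pos.le _
    _ = 3 * (G.c * G.r (G.digit s)) ^ β := by
        rw [Real.mul_rpow G.c_pos.le (G.r_pos _).le]
        ring
    _ ≤ _ := by
        gcongr
        exact mul_nonneg G.c_pos.le (G.r_pos _).le

lemma abs_sub_le_of_pow_lt (hβ : 0 < β) (n : ℕ) : ∀ {s t : ℝ}, s ∈ Ioc (0 : ℝ) 1 →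
    t ∈ Ioc (0 : ℝ) 1 → ((1 / 2 : ℝ) ^ β) ^ n < |s - t| →
    |s - t| * G.c ^ β ≤ 3 * |G.lift s - G.lift t| ^ β := by
  induction n with
  | zero =>
    intro s t hs ht h
    rw [pow_zero] at h
    exact absurd h (not_lt.2 (abs_le.2 ⟨by linarith [hs.1, ht.2], by linarith [hs.2, ht.1]⟩))
  | succ n ih =>
    intro s t hs ht h
    rcases lt_trichotomy (G.digit s) (G.digit t) with hd | hd | hd
    · exact G.abs_sub_le_of_digit_lt hβ hs ht hd
    · have hr := G.r_pos (G.digit s)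
      have hp := Real.rpow_pos_of_pos hr β
      have h1 : |s - t| = G.r (G.digit s) ^ β * |G.next s - G.next t| := by
        have h2 : s - t = G.r (G.digit s) ^ β * (G.next s - G.next t) := by
          have h3 := G.eq_add_next s
          have h4 := G.eq_add_next t
          rw [← hd] at h4
          linarith
        rw [h2, abs_mul, abs_of_pos hp]
      have h2 : |G.lift s - G.lift t| =
          G.r (G.digit s) * |G.lift (G.next s) - G.lift (G.next t)| := by
        rw [G.abs_sub_eq (G.lift_mem_V s) (hd ▸ G.lift_mem_V t), G.T_lift, G.T_lift]
      have h3 : ((1 / 2 : ℝ) ^ β) ^ n < |G.next s - G.next t| := by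
        have h4 : G.r (G.digit s) ^ β ≤ (1 / 2) ^ β :=
          Real.rpow_le_rpow hr.le (G.r_le_half _) hβ.le
        rw [h1, pow_succ'] at h
        have h5 : (0 : ℝ) < (1 / 2) ^ β := by positivity
        refine lt_of_mul_lt_mul_left (h.trans_le ?_) h5.le
        gcongr
      have h4 := mul_le_mul_of_nonneg_left (ih (G.next_mem hs) (G.next_mem ht) h3) hp.le
      rw [h1, h2, Real.mul_rpow hr.le (abs_nonneg _)]
      linarith
    · rw [abs_sub_comm, abs_sub_comm (G.lift s)]
      exact G.abs_sub_le_of_digit_lt hβ ht hs hd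

lemma abs_sub_le (hβ : 0 < β) {s t : ℝ} (hs : s ∈ Ioc (0 : ℝ) 1) (ht : t ∈ Ioc (0 : ℝ) 1) :
    |s - t| * G.c ^ β ≤ 3 * |G.lift s - G.lift t| ^ β := by
  rcases eq_or_ne s t with rfl | hst
  · simp [Real.zero_rpow hβ.ne']
  · obtain ⟨n, hn⟩ := exists_pow_lt_of_lt_one (abs_pos.2 (sub_ne_zero.2 hst))
      (Real.rpow_lt_one (by norm_num : (0 : ℝ) ≤ 1 / 2) (by norm_num) hβ)
    exact G.abs_sub_le_of_pow_lt hβ n hs ht hn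

/-- The repeller has dimension at least `β`, since it contains a set with a `β`-Hölder map onto
`(0,1]`. -/
lemma le_dimH_repeller (hβ : 0 < β) : ENNReal.ofReal β ≤ dimH G.toMarkov.repeller := by
  have hcβ := Real.rpow_pos_of_pos G.c_pos β
  have hinj : InjOn G.lift (Ioc (0 : ℝ) 1) := fun s hs t ht h => by
    have := G.abs_sub_le hβ hs ht
    rw [h, sub_self, abs_zero, Real.zero_rpow hβ.ne', mul_zero] at this
    exact sub_eq_zero.1 (abs_nonpos_iff.1 (nonpos_of_mul_nonpos_left this hcβ))
  have hhol : HolderOnWith (3 / G.c ^ β).toNNReal β.toNNReal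
      (Function.invFunOn G.lift (Ioc (0 : ℝ) 1)) (G.lift '' Ioc (0 : ℝ) 1) := by
    rintro _ ⟨s, hs, rfl⟩ _ ⟨t, ht, rfl⟩
    rw [hinj.leftInvOn_invFunOn hs, hinj.leftInvOn_invFunOn ht, edist_dist, edist_dist,
      Real.coe_toNNReal _ hβ.le, ENNReal.ofReal_rpow_of_nonneg dist_nonneg hβ.le]
    change _ ≤ ENNReal.ofReal _ * _
    rw [← ENNReal.ofReal_mul (by positivity), Real.dist_eq, Real.dist_eq]
    refine ENNReal.ofReal_le_ofReal ?_
    rw [div_mul_eq_mul_div, le_div_iff₀ hcβ]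
    exact G.abs_sub_le hβ hs ht
  have h1 := hhol.dimH_image_le (Real.toNNReal_pos.2 hβ)
  rw [hinj.invFunOn_image subset_rfl, Real.dimH_of_nonempty_interior (by
    rw [interior_Ioc]; exact nonempty_Ioo.2 one_pos), Module.finrank_self, Nat.cast_one,
    ENNReal.le_div_iff_mul_le (Or.inl (by simpa using hβ)) (Or.inl ENNReal.coe_ne_top),
    one_mul] at h1
  refine h1.trans (dimH_mono ?_)
  rintro _ ⟨t, -, rfl⟩
  exact G.lift_mem_repeller t

lemma zero_mem_closure_repeller : (0 : ℝ) ∈ closure G.toMarkov.repeller := by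
  refine mem_closure_of_tendsto (b := atTop) (f := fun i => G.lift (G.tailMass (i + 1)))
    (squeeze_zero (fun i => (G.lift_mem_Icc _).1) (fun i => ?_) G.a_lim)
    (Eventually.of_forall fun i => G.lift_mem_repeller _)
  have hpos : 0 < G.tailMass (i + 1) := by
    rw [G.tailMass_eq]
    exact add_pos_of_pos_of_nonneg (Real.rpow_pos_of_pos (G.r_pos _) β) (G.tailMass_nonneg _)
  have hle : G.tailMass (i + 1) ≤ 1 :=
    G.tailMass_zero ▸ G.tailMass_antitone (Nat.zero_le (i + 1))
  have hlt := G.tailMass_antitone.reflect_lt (G.tailMass_digit_lt ⟨hpos, hle⟩)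
  exact (G.lift_mem_V _).2.trans (G.top_lt (by omega)).le

end GapSystem

lemma exists_halving_seq_le {θ : ℕ → ℝ} (hθ : ∀ n, 0 < θ n) :
    ∃ q : ℕ → ℝ, (∀ n, 0 < q n) ∧ (∀ n, q n ≤ θ n) ∧ ∀ n, q (n + 1) ≤ q n / 2 := by
  let q : ℕ → ℝ := fun n => Nat.rec (θ 0) (fun k x => min (x / 2) (θ (k + 1))) n
  have hpos : ∀ n, 0 < q n := fun n => by
    induction n with
    | zero => exact hθ 0
    | succ n ih => exact lt_min (half_pos ih) (hθ (n + 1))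
  refine ⟨q, hpos, fun n => ?_, fun n => min_le_left _ _⟩
  cases n with
  | zero => exact le_rfl
  | succ n => exact min_le_right _ _

lemma halving_seq_tail_le {q : ℕ → ℝ} (h0 : ∀ n, 0 < q n) (h : ∀ n, q (n + 1) ≤ q n / 2) :
    Summable q ∧ ∀ i, ∑' k, q (k + i) ≤ 2 * q i := by
  have hle : ∀ i k, q (k + i) ≤ q i * (1 / 2) ^ k := fun i k => by
    induction k with
    | zero => simp
    | succ k ih =>
      have := h (k + i)
      rw [add_right_comm, pow_succ]
      linarith
  have hs : ∀ i, Summable fun k : ℕ => q i * (1 / 2) ^ k := fun i =>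
    summable_geometric_two.mul_left _
  have hsum : ∀ i, Summable fun k => q (k + i) := fun i =>
    Summable.of_nonneg_of_le (fun k => (h0 _).le) (hle i) (hs i)
  refine ⟨by simpa using hsum 0, fun i => ?_⟩
  refine ((hsum i).tsum_le_tsum (hle i) (hs i)).trans_eq ?_
  rw [tsum_mul_left, tsum_geometric_two, mul_comm]

lemma summable_rpow_mul_pow_of_le {r : ℕ → ℝ} (h0 : ∀ k, 0 < r k)
    (h : ∀ k, r k ≤ 2 * (1 / 2) ^ (k ^ 2)) {s : ℝ} (hs : 0 < s) {D : ℝ} (hD : 0 ≤ D) :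
    Summable fun k => r k ^ s * D ^ k := by
  set x : ℝ := (1 / 2) ^ s
  have hx0 : 0 < x := by positivity
  have hx1 : x < 1 := Real.rpow_lt_one (by norm_num) (by norm_num) hs
  have hle : ∀ k, r k ^ s * D ^ k ≤ 2 ^ s * (x ^ k * D) ^ k := fun k => by
    have h1 : r k ^ s ≤ 2 ^ s * x ^ (k ^ 2) := by
      refine (Real.rpow_le_rpow (h0 k).le (h k) hs.le).trans_eq ?_
      rw [Real.mul_rpow (by norm_num) (by positivity), ← Real.rpow_natCast, ← Real.rpow_natCast,
        ← Real.rpow_mul (by norm_num), ← Real.rpow_mul (by norm_num), mul_comm s]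
    refine (mul_le_mul_of_nonneg_right h1 (by positivity)).trans_eq ?_
    rw [mul_pow, ← pow_mul, sq, mul_assoc]
  have hlim : Tendsto (fun k : ℕ => x ^ k * D) atTop (𝓝 0) := by
    simpa using (tendsto_pow_atTop_nhds_zero_of_lt_one hx0.le hx1).mul_const D
  refine Summable.of_norm_bounded_eventually_nat (g := fun k => 2 ^ s * (1 / 2) ^ k)
    (summable_geometric_two.mul_left _) ?_
  filter_upwards [hlim.eventually_lt_const (by norm_num : (0 : ℝ) < 1 / 2)] with k hk
  rw [Real.norm_of_nonneg (mul_nonneg (Real.rpow_nonneg (h0 k).le _) (by positivity))]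
  refine (hle k).trans ?_
  gcongr

/-- A system of intervals of dimension `β` adapted to the radii `Φ`: two long intervals near `1`,
and very short ones squeezed between consecutive values of `Φ`. -/
lemma exists_gapSystem {Φ : ℕ → ℝ} (hΦpos : ∀ n, 0 < Φ n) (hΦanti : StrictAnti Φ)
    (hΦlim : Tendsto Φ atTop (𝓝 0)) {β : ℝ} (hβ0 : 0 < β) (hβ1 : β < 1) :
    ∃ (G : GapSystem β) (M : ℕ), (∀ i, Φ (i + M) ≤ G.a i) ∧
      ∀ k, G.r k ≤ 2 * (1 / 2) ^ (k ^ 2) := by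
  set η : ℝ := 1 - 2 * (1 / 2) ^ β⁻¹
  have hb : 1 < β⁻¹ := (one_lt_inv₀ hβ0).2 hβ1
  have hη : 0 < η := by
    have : (1 / 2 : ℝ) ^ β⁻¹ < (1 / 2) ^ (1 : ℝ) :=
      Real.rpow_lt_rpow_of_exponent_gt (by norm_num) (by norm_num) hb
    rw [Real.rpow_one] at this
    linarith
  have hη1 : η < 1 := by
    have : (0 : ℝ) < (1 / 2) ^ β⁻¹ := by positivity
    linarith
  obtain ⟨M, hM⟩ := (hΦlim.eventually_lt_const (half_pos hη)).exists
  set θ : ℕ → ℝ := fun k => min ((Φ (k + 1 + M) - Φ (k + 2 + M)) / 2) ((1 / 2) ^ ((k + 2) ^ 2))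
  have hgap : ∀ k, 0 < Φ (k + 1 + M) - Φ (k + 2 + M) := fun k =>
    sub_pos.2 (hΦanti (by omega))
  obtain ⟨q, hq0, hqθ, hq2⟩ := exists_halving_seq_le (θ := θ) fun k =>
    lt_min (half_pos (hgap k)) (by positivity)
  obtain ⟨hqs, hqt⟩ := halving_seq_tail_le hq0 hq2
  have hq_gap : ∀ k, 2 * q k ≤ Φ (k + 1 + M) - Φ (k + 2 + M) := fun k => by
    have := (hqθ k).trans (min_le_left _ _)
    linarith
  have hq_pow : ∀ k, q k ≤ (1 / 2) ^ ((k + 2) ^ 2) := fun k => (hqθ k).trans (min_le_right _ _)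
  have hq_half : ∀ k, q k ≤ 1 / 2 := fun k =>
    (hq_pow k).trans (pow_le_of_le_one (by norm_num) (by norm_num) (by positivity))
  set ε := ∑' k, q k
  have hε0 : 0 ≤ ε := tsum_nonneg fun k => (hq0 k).le
  have hε : ε ≤ 1 / 8 := by
    have h1 := hqt 0
    have h2 := hq_pow 0
    norm_num at h1 h2
    exact h1.trans (by linarith)
  set p : ℕ → ℝ := fun k => if k < 2 then (1 - ε) / 2 else q (k - 2) with hp_def
  have hp_small : ∀ k, p (k + 2) = q k := fun k => by simp [hp_def]
  have hp0 : p 0 = (1 - ε) / 2 := by simp [hp_def]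
  have hp1 : p 1 = (1 - ε) / 2 := by simp [hp_def]
  have hp_pos : ∀ k, 0 < p k := fun k => by
    simp only [hp_def]
    split_ifs
    · linarith
    · exact hq0 _
  have hp_half : ∀ k, p k ≤ 1 / 2 := fun k => by
    simp only [hp_def]
    split_ifs
    · linarith
    · exact hq_half _
  have hp_sum : HasSum p 1 := by
    rw [← hasSum_nat_add_iff' 2]
    have : (1 : ℝ) - ∑ i ∈ Finset.range 2, p i = ε := by
      rw [Finset.sum_range_succ, Finset.sum_range_one, hp0, hp1]
      ring
    rw [this]
    simpa only [hp_small] using hqs.hasSum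
  have hp_tail_one : ∀ i, ∑' k, p (k + i) ≤ 1 := fun i => by
    have h1 := hp_sum.summable.sum_add_tsum_nat_add i
    rw [hp_sum.tsum_eq] at h1
    have h2 : 0 ≤ ∑ k ∈ Finset.range i, p k := Finset.sum_nonneg fun k _ => (hp_pos k).le
    linarith
  have hp_tail : ∀ i, ∑' k, p (k + i) ≤ 3 * p i := by
    rintro (_ | _ | i)
    · exact (hp_tail_one 0).trans (by rw [hp0]; linarith)
    · exact (hp_tail_one 1).trans (by rw [zero_add, hp1]; linarith)
    · have h1 : ∀ k, p (k + (i + 1 + 1)) = q (k + i) := fun k => hp_small (k + i)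
      simp only [h1]
      rw [show p (i + 1 + 1) = q i from hp_small i]
      linarith [hqt i, hq0 i]
  set r : ℕ → ℝ := fun k => p k ^ β⁻¹ with hr_def
  have hr_pos : ∀ k, 0 < r k := fun k => Real.rpow_pos_of_pos (hp_pos k) _
  have hr_le : ∀ k, r k ≤ p k := fun k =>
    Real.rpow_le_self_of_le_one (hp_pos k).le ((hp_half k).trans (by norm_num)) hb.le
  have hr_half : ∀ k, r k ≤ 1 / 2 := fun k => (hr_le k).trans (hp_half k)
  have hr_rpow : ∀ k, r k ^ β = p k := fun k => Real.rpow_inv_rpow (hp_pos k).le hβ0.ne'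
  have hr_eta : ∀ k, 2 * r k ≤ 1 - η := fun k => by
    have := Real.rpow_le_rpow (hp_pos k).le (hp_half k) (inv_nonneg.2 hβ0.le)
    simp only [hr_def]
    linarith
  have hr01 : r 1 = r 0 := by simp only [hr_def, hp0, hp1]
  set a : ℕ → ℝ := fun k => if k = 0 then 1 - r 0 else if k = 1 then 1 - 2 * r 0 - η / 4
    else Φ (k + M) + η / 4 * r k with ha_def
  have ha0 : a 0 = 1 - r 0 := by simp [ha_def]
  have ha1 : a 1 = 1 - 2 * r 0 - η / 4 := by simp [ha_def]
  have ha_small : ∀ k, a (k + 2) = Φ (k + 2 + M) + η / 4 * r (k + 2) := fun k => by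
    simp [ha_def]
  have hmul : ∀ k, η / 4 * r k ≤ η / 4 := fun k =>
    mul_le_of_le_one_right (by linarith) ((hr_half k).trans (by norm_num))
  have hmul' : ∀ k, η / 4 * r k ≤ r k := fun k =>
    mul_le_of_le_one_left (hr_pos k).le (by linarith)
  have hmul_pos : ∀ k, 0 < η / 4 * r k := fun k => mul_pos (by linarith) (hr_pos k)
  have hΦM : ∀ k, Φ (k + M) < η / 2 := fun k =>
    (hΦanti.antitone (Nat.le_add_left M k)).trans_lt hM
  have haΦ : ∀ k, Φ (k + M) ≤ a k := by
    rintro (_ | _ | k)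
    · rw [ha0]
      linarith [hΦM 0, hr_eta 0]
    · rw [zero_add, ha1]
      linarith [hΦM 1, hr_eta 0]
    · rw [ha_small k]
      linarith [hmul_pos (k + 2)]
  have htop : ∀ k, a (k + 2) + r (k + 2) ≤ Φ (k + 1 + M) := fun k => by
    rw [ha_small]
    linarith [hmul' (k + 2), hr_le (k + 2), hp_small k, hq_gap k]
  refine ⟨⟨r, a, η / 4, hr_pos, hr_half, fun i => (hΦpos _).le.trans (haΦ i), ?_, by linarith, ?_,
    ?_, by simpa only [hr_rpow] using hp_sum, by simpa only [hr_rpow] using hp_tail⟩, M, haΦ, ?_⟩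
  · rw [ha0]
    linarith
  · rintro (_ | _ | k)
    · rw [zero_add, ha0, ha1, hr01]
      linarith [hmul 0]
    · rw [zero_add, ha1, hr01]
      linarith [hmul 0, hr_eta 0, hΦM 1, htop 0]
    · rw [ha_small k]
      linarith [htop (k + 1)]
  · have h1 : Tendsto (fun k => Φ (k + 1 + M)) atTop (𝓝 0) :=
      hΦlim.comp ((tendsto_add_atTop_nat M).comp (tendsto_add_atTop_nat 1))
    refine (tendsto_add_atTop_iff_nat 2).1 (squeeze_zero (fun k => ?_) (fun k => ?_) h1)
    · exact (hΦpos _).le.trans (haΦ _)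
    · linarith [htop k, hr_pos (k + 2)]
  · rintro (_ | _ | k)
    · exact (hr_half 0).trans (by norm_num)
    · exact (hr_half 1).trans (by norm_num)
    · refine ((hr_le (k + 2)).trans ((hp_small k).trans_le (hq_pow k))).trans ?_
      exact le_mul_of_one_le_left (by positivity) (by norm_num)

/-- For any strictly decreasing `Φ : ℕ → ℝ_{>0}` tending to `0` and any `β ∈ (0,1)` there
is an expanding Markov map with repeller of Hausdorff dimension `β` and a point
`y ∈ closure Λ` with `dim S_y(Φ) = 0`. -/
theorem exists_expandingMarkovMap_dimH_shrinkingTargetSeq_eq_zero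
    (Φ : ℕ → ℝ) (hΦpos : ∀ n, 0 < Φ n) (hΦanti : StrictAnti Φ)
    (hΦlim : Tendsto Φ atTop (𝓝 0)) (β : ℝ) (hβ : β ∈ Set.Ioo (0:ℝ) 1) :
    ∃ (A : Type) (M : ExpandingMarkovMap A) (y : ℝ),
      dimH M.repeller = ENNReal.ofReal β ∧ y ∈ closure M.repeller ∧
      dimH (M.shrinkingTargetSeq y Φ) = 0 := by

  obtain ⟨G, M, ha, hr⟩ := exists_gapSystem hΦpos hΦanti hΦlim hβ.1 hβ.2
  exact ⟨ℕ, G.toMarkov, 0, le_antisymm (G.dimH_repeller_le hβ.1) (G.le_dimH_repeller hβ.1),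
    G.zero_mem_closure_repeller, G.dimH_shrinkingTargetSeq hΦanti.antitone ha
      fun s hs D hD => summable_rpow_mul_pow_of_le G.r_pos hr hs hD⟩
end
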